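/- Let T > 0 and let (u,p) be a smooth solution of the three-dimensional Navier–Stokes equations on [0,T) × ℝ³ with u(t,·) Schwartz for each t. Let c₀ > 0 be a constant such that |⟨Λ^{3/2}[(v·∇)v], Λ^{3/2} v⟩_{L²}| ≤ c₀‖v‖²_{Ḣ^{3/2}}‖v‖_{Ḣ^{5/2}} for all divergence-free Schwartz vector fields v on ℝ³. Suppose ε > 0 satisfies 2c₀ε < 1, and suppose that for some τ ∈ [0,T) one has ‖u(t)‖_{Ḣ^{5/2}} ≤ ε·(T−t)^{−1} for all t ∈ [τ,T). Then for all t ∈ [τ,T), ‖u(t)‖²_{Ḣ^{3/2}} ≤ ‖u(τ)‖²_{Ḣ^{3/2}}·(T−τ)^{2c₀ε}·(T−t)^{−2c₀ε}; in particular (T−t)^{2c₀ε}·‖u(t)‖²_{Ḣ^{3/2}} is bounded on [τ,T). -/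

import Mathlib

open MeasureTheory Filter SchwartzMap
open scoped FourierTransform

noncomputable section

abbrev Ell (n : ℕ) := EuclideanSpace ℝ (Fin n)

def eVec (n : ℕ) (i : Fin n) : Ell n := EuclideanSpace.single i 1

/-- coercion of a real-valued function to a complex-valued one -/
def cf {n : ℕ} (f : Ell n → ℝ) : Ell n → ℂ := fun x => (f x : ℂ)

/-- the Fourier multiplier operator `Λ^s` with symbol `|ξ|^s` -/
def Lam {n : ℕ} (s : ℝ) (f : Ell n → ℂ) : Ell n → ℂ :=
  𝓕⁻ (fun ξ => ((‖ξ‖ ^ s : ℝ) : ℂ) * 𝓕 f ξ)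

/-- the partial derivative `∂ᵢ` -/
def pd {n : ℕ} (i : Fin n) (f : Ell n → ℂ) : Ell n → ℂ :=
  fun x => fderiv ℝ f x (eVec n i)

/-- the advection term `(v·∇)w` for complex vector fields -/
def adv {n : ℕ} (v w : Fin n → Ell n → ℂ) : Fin n → Ell n → ℂ :=
  fun l x => ∑ i, v i x * pd i (w l) x

/-- squared homogeneous Sobolev norm of a complex scalar function -/
def HsqC {n : ℕ} (s : ℝ) (f : Ell n → ℂ) : ℝ :=
  ∫ ξ, ‖ξ‖ ^ (2 * s) * ‖𝓕 f ξ‖ ^ 2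

/-- homogeneous Sobolev norm `‖u‖_{Ḣ^s}` of a real vector field -/
def Hnorm {n : ℕ} (s : ℝ) (u : Fin n → Ell n → ℝ) : ℝ :=
  Real.sqrt (∑ l, HsqC s (cf (u l)))

/-- `L²` norm of a complex vector field -/
def vL2 {n : ℕ} (f : Fin n → Ell n → ℂ) : ℝ :=
  Real.sqrt (∑ l, ∫ x, ‖f l x‖ ^ 2)

/-- `L²` pairing `⟨f,g⟩ = Σ_l ∫ f_l g_l` of complex vector fields -/
def Cinner {n : ℕ} (f g : Fin n → Ell n → ℂ) : ℂ :=
  ∑ l, ∫ x, f l x * g l x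

/-- `(u, p)` is a smooth solution of the 3D Navier–Stokes equations on `[0,T) × ℝ³`
with `u(t,·)` Schwartz for each `t`: `u` and `p` are smooth on `[0,T) × ℝ³`, each
time-slice of `u` is a Schwartz vector field, `div u = 0`, and
`∂ₜu − Δu + (u·∇)u + ∇p = 0` pointwise. -/
def IsNSSolution (T : ℝ) (u : ℝ → Ell 3 → Fin 3 → ℝ) (p : ℝ → Ell 3 → ℝ) : Prop :=
  (∀ l, ContDiffOn ℝ (⊤ : ℕ∞) (fun q : ℝ × Ell 3 => u q.1 q.2 l) (Set.Ico 0 T ×ˢ Set.univ)) ∧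
  ContDiffOn ℝ (⊤ : ℕ∞) (fun q : ℝ × Ell 3 => p q.1 q.2) (Set.Ico 0 T ×ˢ Set.univ) ∧
  (∀ t ∈ Set.Ico (0 : ℝ) T, ∀ l, ∃ f : 𝓢(Ell 3, ℝ), ∀ x, u t x l = f x) ∧
  (∀ t ∈ Set.Ico (0 : ℝ) T, ∀ x, ∑ i, fderiv ℝ (fun y => u t y i) x (eVec 3 i) = 0) ∧
  (∀ t ∈ Set.Ico (0 : ℝ) T, ∀ x, ∀ l, HasDerivWithinAt (fun s => u s x l)
    ((∑ i, fderiv ℝ (fun y => fderiv ℝ (fun z => u t z l) y (eVec 3 i)) x (eVec 3 i))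
      - (∑ i, u t x i * fderiv ℝ (fun z => u t z l) x (eVec 3 i))
      - fderiv ℝ (fun z => p t z) x (eVec 3 l)) (Set.Ico 0 T) t)

section Prelude

open scoped InnerProductSpace ComplexConjugate LineDeriv Laplacian

open Set in
open scoped Topology in
/-- A continuous function whose left upper Dini derivative is nonpositive does not increase. -/
theorem le_of_left_dini_nonpos {f : ℝ → ℝ} {a b : ℝ} (hab : a ≤ b)
    (hf : ContinuousOn f (Icc a b))
    (hd : ∀ t ∈ Ioc a b, ∀ η > 0, ∀ᶠ s in 𝓝[<] t, f t - f s ≤ η * (t - s)) : f b ≤ f a := by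
  have hmap : MapsTo (fun x : ℝ => -x) (Icc (-b) (-a)) (Icc a b) := fun x hx =>
    ⟨by linarith [hx.2], by linarith [hx.1]⟩
  have key2 := image_le_of_liminf_slope_right_le_deriv_boundary (f := fun x => -f (-x))
    (B := fun _ => -f b) (B' := fun _ => 0) (a := -b) (b := -a)
    (hf.comp continuous_neg.continuousOn hmap).neg (by simp) continuousOn_const
    (fun x _ => hasDerivWithinAt_const _ _ _) ?_ (right_mem_Icc.2 (by linarith))
  · simpa using key2
  · intro x hx r hr
    have h1 := hd (-x) ⟨by linarith [hx.2], by linarith [hx.1]⟩ (r / 2) (by linarith)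
    have h2 : Tendsto (fun z : ℝ => -z) (𝓝[>] x) (𝓝[<] (-x)) := by
      refine tendsto_nhdsWithin_iff.2 ⟨(continuous_neg.tendsto x).mono_left nhdsWithin_le_nhds, ?_⟩
      filter_upwards [self_mem_nhdsWithin] with z hz
      simpa using hz
    refine Eventually.frequently ?_
    filter_upwards [h2.eventually h1, self_mem_nhdsWithin] with z hz hxz
    have hxz' : 0 < z - x := sub_pos.2 hxz
    rw [slope_def_field, div_lt_iff₀ hxz']
    nlinarith

open Set in
open scoped Topology in
/-- Gronwall-type monotonicity with an integrating factor `ψ`, using left Dini derivatives. -/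
theorem mul_le_mul_of_left_dini {f ψ ψ' c : ℝ → ℝ} {a b : ℝ} (hab : a ≤ b)
    (hf : ContinuousOn f (Icc a b)) (hψ : ∀ t ∈ Icc a b, HasDerivAt ψ (ψ' t) t)
    (hψ0 : ∀ t ∈ Icc a b, 0 < ψ t)
    (hc : ∀ t ∈ Ioc a b, c t * ψ t + f t * ψ' t ≤ 0)
    (hd : ∀ t ∈ Ioc a b, ∀ η > 0, ∀ᶠ s in 𝓝[<] t, f t - f s ≤ (c t + η) * (t - s)) :
    f b * ψ b ≤ f a * ψ a := by
  refine le_of_left_dini_nonpos (f := fun t => f t * ψ t) hab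
    (hf.mul fun t ht => (hψ t ht).continuousAt.continuousWithinAt) ?_
  intro t ht η hη
  have htI : t ∈ Icc a b := Ioc_subset_Icc_self ht
  have hp := hψ0 t htI
  set η' := η / (3 * ψ t) with hη'
  have hη'0 : 0 < η' := by positivity
  have h1 := hd t ht η' hη'0
  have hcont : ContinuousAt ψ t := (hψ t htI).continuousAt
  have h2 : ∀ᶠ s in 𝓝[<] t, (c t + η') * ψ s < (c t + η') * ψ t + η / 3 := by
    have : Tendsto (fun s => (c t + η') * ψ s) (𝓝[<] t) (𝓝 ((c t + η') * ψ t)) :=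
      (hcont.tendsto.const_mul _).mono_left nhdsWithin_le_nhds
    exact this.eventually (gt_mem_nhds (by linarith))
  have h3 : ∀ᶠ s in 𝓝[<] t, 0 < ψ s :=
    (hcont.eventually (lt_mem_nhds hp)).filter_mono nhdsWithin_le_nhds
  have h4 : ∀ᶠ s in 𝓝[<] t, f t * slope ψ t s < f t * ψ' t + η / 3 := by
    have : Tendsto (slope ψ t) (𝓝[<] t) (𝓝 (ψ' t)) :=
      (hasDerivAt_iff_tendsto_slope.1 (hψ t htI)).mono_left
        (nhdsWithin_mono _ fun x hx => ne_of_lt hx)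
    exact (this.const_mul (f t)).eventually (gt_mem_nhds (by linarith))
  filter_upwards [h1, h2, h3, h4, self_mem_nhdsWithin] with s g1 g2 g3 g4 hs
  have hts : 0 < t - s := sub_pos.2 hs
  have e4 : f t * (ψ t - ψ s) = f t * slope ψ t s * (t - s) := by
    rw [slope_def_field]
    have : s - t ≠ 0 := by linarith
    field_simp
    ring
  have hη3 : η' * ψ t = η / 3 := by rw [hη']; field_simp
  have hcc := hc t ht
  calc f t * ψ t - f s * ψ s = (f t - f s) * ψ s + f t * (ψ t - ψ s) := by ring
    _ ≤ (c t + η') * (t - s) * ψ s + f t * slope ψ t s * (t - s) := by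
        rw [e4]; gcongr
    _ = ((c t + η') * ψ s + f t * slope ψ t s) * (t - s) := by ring
    _ ≤ η * (t - s) := by
        refine mul_le_mul_of_nonneg_right ?_ hts.le
        nlinarith

section Hilbert

variable {H : Type*} [NormedAddCommGroup H] [InnerProductSpace ℂ H]

/-- `w` is an admissible test vector for the evolution `U' = X` on `[a, b]`. -/
def IsTest (U X : ℝ → H) (a b : ℝ) (w : H) : Prop :=
  ContinuousOn (fun r => ⟪w, X r⟫_ℂ) (Set.Icc a b) ∧
    ∀ s ∈ Set.Icc a b, ∀ t ∈ Set.Icc a b, s ≤ t →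
      ⟪w, U t - U s⟫_ℂ = ∫ r in s..t, ⟪w, X r⟫_ℂ

variable {U X : ℝ → H} {a b : ℝ}

theorem IsTest.intervalIntegrable {w : H} (h : IsTest U X a b w) {s t : ℝ}
    (hs : s ∈ Set.Icc a b) (ht : t ∈ Set.Icc a b) :
    IntervalIntegrable (fun r => ⟪w, X r⟫_ℂ) volume s t :=
  (h.1.mono (Set.uIcc_subset_Icc hs ht)).intervalIntegrable

theorem IsTest.zero : IsTest U X a b 0 := by
  refine ⟨by simpa using continuousOn_const, fun s _ t _ _ => by simp⟩

theorem IsTest.add {w w' : H} (h : IsTest U X a b w) (h' : IsTest U X a b w') :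
    IsTest U X a b (w + w') := by
  refine ⟨(h.1.add h'.1).congr fun r _ => inner_add_left _ _ _, fun s hs t ht hst => ?_⟩
  simp only [inner_add_left]
  rw [intervalIntegral.integral_add (h.intervalIntegrable hs ht) (h'.intervalIntegrable hs ht),
    h.2 s hs t ht hst, h'.2 s hs t ht hst]

theorem IsTest.smul {w : H} (h : IsTest U X a b w) (c : ℂ) : IsTest U X a b (c • w) := by
  refine ⟨?_, fun s hs t ht hst => ?_⟩
  · exact (continuousOn_const.mul h.1).congr fun r _ => inner_smul_left _ _ _
  · simp only [inner_smul_left]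
    rw [intervalIntegral.integral_const_mul, h.2 s hs t ht hst]

theorem IsTest.sub {w w' : H} (h : IsTest U X a b w) (h' : IsTest U X a b w') :
    IsTest U X a b (w - w') := by
  simpa [sub_eq_add_neg] using h.add (h'.smul (-1))

theorem IsTest.sum {ι : Type*} (s : Finset ι) {w : ι → H} (h : ∀ i ∈ s, IsTest U X a b (w i)) :
    IsTest U X a b (∑ i ∈ s, w i) := by
  classical
  induction s using Finset.induction_on with
  | empty => simpa using IsTest.zero
  | insert i s hi ih =>
    rw [Finset.sum_insert hi]
    exact (h i (by simp)).add (ih fun j hj => h j (by simp [hj]))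

open scoped Topology in
/-- Test vectors form a closed set when `X` is bounded. -/
theorem IsTest.of_tendsto {C : ℝ} (hX : ∀ r ∈ Set.Icc a b, ‖X r‖ ≤ C) {w : ℕ → H} {w₀ : H}
    (hw : ∀ n, IsTest U X a b (w n)) (hlim : Tendsto w atTop (𝓝 w₀)) : IsTest U X a b w₀ := by
  have hunif : TendstoUniformlyOn (fun n r => ⟪w n, X r⟫_ℂ) (fun r => ⟪w₀, X r⟫_ℂ) atTop
      (Set.Icc a b) := by
    rw [Metric.tendstoUniformlyOn_iff]
    intro e he
    have h0 : Tendsto (fun n => ‖w₀ - w n‖ * C) atTop (𝓝 0) := by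
      have : Tendsto (fun n => ‖w₀ - w n‖) atTop (𝓝 0) := by
        simpa using ((tendsto_const_nhds (x := w₀)).sub hlim).norm
      simpa using this.mul_const C
    filter_upwards [h0.eventually (gt_mem_nhds he)] with n hn r hr
    rw [dist_eq_norm, ← inner_sub_left]
    calc _ ≤ ‖w₀ - w n‖ * ‖X r‖ := norm_inner_le_norm _ _
      _ ≤ ‖w₀ - w n‖ * C := by gcongr; exact hX r hr
      _ < e := hn
  have hcont := hunif.continuousOn (Eventually.of_forall fun n => (hw n).1).frequently
  refine ⟨hcont, fun s hs t ht hst => ?_⟩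
  have h1 : Tendsto (fun n => ⟪w n, U t - U s⟫_ℂ) atTop (𝓝 ⟪w₀, U t - U s⟫_ℂ) :=
    hlim.inner tendsto_const_nhds
  have hCn : 0 ≤ C := (norm_nonneg _).trans (hX s hs)
  have h2 : Tendsto (fun n => ∫ r in s..t, ⟪w n, X r⟫_ℂ) atTop
      (𝓝 (∫ r in s..t, ⟪w₀, X r⟫_ℂ)) := by
    obtain ⟨M, hM⟩ := hlim.norm.bddAbove_range
    have hsub : Set.uIoc s t ⊆ Set.Icc a b :=
      Set.uIoc_subset_uIcc.trans (Set.uIcc_subset_Icc hs ht)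
    refine intervalIntegral.tendsto_integral_filter_of_dominated_convergence (fun _ => M * C)
      ?_ ?_ intervalIntegrable_const ?_
    · exact Eventually.of_forall fun n =>
        (((hw n).1.mono hsub).aestronglyMeasurable measurableSet_uIoc)
    · refine Eventually.of_forall fun n => Eventually.of_forall fun r hr => ?_
      refine (norm_inner_le_norm _ _).trans ?_
      have : ‖w n‖ ≤ M := hM ⟨n, rfl⟩
      have hM0 : 0 ≤ M := (norm_nonneg _).trans this
      have := hX r (hsub hr)
      gcongr
    · exact Eventually.of_forall fun r _ => hlim.inner tendsto_const_nhds
  refine tendsto_nhds_unique h1 ?_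
  simpa only [(hw _).2 s hs t ht hst] using h2

/-- An evolution tested by its own increments is Lipschitz. -/
theorem norm_sub_le_of_isTest {C : ℝ} (hX : ∀ r ∈ Set.Icc a b, ‖X r‖ ≤ C)
    (hU : ∀ t ∈ Set.Icc a b, IsTest U X a b (U t)) {s t : ℝ} (hs : s ∈ Set.Icc a b)
    (ht : t ∈ Set.Icc a b) (hst : s ≤ t) : ‖U t - U s‖ ≤ C * (t - s) := by
  have hT := (hU t ht).sub (hU s hs)
  have h1 := hT.2 s hs t ht hst
  have h2 : ‖U t - U s‖ * ‖U t - U s‖ ≤ ‖U t - U s‖ * C * (t - s) := by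
    have : ‖⟪U t - U s, U t - U s⟫_ℂ‖ = ‖U t - U s‖ * ‖U t - U s‖ := by
      rw [inner_self_eq_norm_sq_to_K]; simp [sq]
    rw [← this, h1]
    have := intervalIntegral.norm_integral_le_of_norm_le_const (a := s) (b := t)
      (f := fun r => ⟪U t - U s, X r⟫_ℂ) (C := ‖U t - U s‖ * C) ?_
    · rwa [abs_of_nonneg (sub_nonneg.2 hst)] at this
    · intro r hr
      refine (norm_inner_le_norm _ _).trans ?_
      gcongr
      exact hX r (Set.uIcc_subset_Icc hs ht (Set.uIoc_subset_uIcc hr))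
  rcases (norm_nonneg (U t - U s)).eq_or_lt with h0 | h0
  · rw [← h0]
    exact mul_nonneg ((norm_nonneg _).trans (hX s hs)) (sub_nonneg.2 hst)
  · rw [mul_assoc] at h2
    exact le_of_mul_le_mul_left h2 h0

open scoped Topology in
/-- Pairing an increment against a fixed test vector is controlled by the value of `X` at the
right endpoint. -/
theorem IsTest.abs_re_inner_sub_le {w : H} (hw : IsTest U X a b w) {t : ℝ}
    (ht : t ∈ Set.Ioc a b) {η : ℝ} (hη : 0 < η) :
    ∀ᶠ s in 𝓝[<] t, |(⟪w, U t - U s⟫_ℂ).re - (⟪w, X t⟫_ℂ).re * (t - s)| ≤ η * (t - s) := by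
  have htI : t ∈ Set.Icc a b := Set.Ioc_subset_Icc_self ht
  have hc := hw.1 t htI
  have h1 : ∀ᶠ r in 𝓝[Set.Icc a b] t, ‖⟪w, X r⟫_ℂ - ⟪w, X t⟫_ℂ‖ < η := by
    have := Metric.tendsto_nhds.1 hc η hη
    simpa only [dist_eq_norm] using this
  rw [eventually_nhdsWithin_iff, Metric.eventually_nhds_iff] at h1
  obtain ⟨δ, hδ, h1⟩ := h1
  have h2 : ∀ᶠ s in 𝓝[<] t, max a (t - δ) < s := by
    exact (lt_mem_nhds (max_lt ht.1 (by linarith))).filter_mono nhdsWithin_le_nhds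
  filter_upwards [h2, self_mem_nhdsWithin] with s hs hst
  have hst' : s < t := hst
  have has : a < s := (le_max_left _ _).trans_lt hs
  have hds : t - δ < s := (le_max_right _ _).trans_lt hs
  have hsI : s ∈ Set.Icc a b := ⟨has.le, hst'.le.trans ht.2⟩
  have hint := hw.intervalIntegrable hsI htI
  have e : ⟪w, U t - U s⟫_ℂ - ⟪w, X t⟫_ℂ * (t - s : ℝ) =
      ∫ r in s..t, (⟪w, X r⟫_ℂ - ⟪w, X t⟫_ℂ) := by
    rw [intervalIntegral.integral_sub hint intervalIntegrable_const, hw.2 s hsI t htI hst'.le,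
      intervalIntegral.integral_const, Complex.real_smul, mul_comm]
  have e2 : (⟪w, U t - U s⟫_ℂ).re - (⟪w, X t⟫_ℂ).re * (t - s) =
      (⟪w, U t - U s⟫_ℂ - ⟪w, X t⟫_ℂ * (t - s : ℝ)).re := by
    rw [Complex.sub_re, Complex.re_mul_ofReal]
  rw [e2, e]
  refine (Complex.abs_re_le_norm _).trans ?_
  have := intervalIntegral.norm_integral_le_of_norm_le_const (a := s) (b := t)
      (f := fun r => ⟪w, X r⟫_ℂ - ⟪w, X t⟫_ℂ) (C := η) ?_
  · rwa [abs_of_pos (sub_pos.2 hst')] at this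
  · intro r hr
    rw [Set.uIoc_of_le hst'.le] at hr
    refine (h1 ?_ ⟨has.le.trans hr.1.le, hr.2.trans ht.2⟩).le
    rw [Real.dist_eq, abs_lt]
    constructor <;> linarith [hr.1, hr.2]

open scoped Topology in
/-- The energy `‖U‖²` has left derivative `2 Re ⟪U, X⟫`. -/
theorem abs_normSq_sub_le_of_isTest {C : ℝ} (hX : ∀ r ∈ Set.Icc a b, ‖X r‖ ≤ C)
    (hU : ∀ t ∈ Set.Icc a b, IsTest U X a b (U t)) {t : ℝ}
    (ht : t ∈ Set.Ioc a b) {η : ℝ} (hη : 0 < η) :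
    ∀ᶠ s in 𝓝[<] t,
      |‖U t‖ ^ 2 - ‖U s‖ ^ 2 - 2 * (⟪U t, X t⟫_ℂ).re * (t - s)| ≤ η * (t - s) := by
  have htI : t ∈ Set.Icc a b := Set.Ioc_subset_Icc_self ht
  have hCn : 0 ≤ C := (norm_nonneg _).trans (hX t htI)
  have h1 := (hU t htI).abs_re_inner_sub_le ht (η := η / 4) (by linarith)
  set δ := η / (2 * (C ^ 2 + 1)) with hδ
  have hδ0 : 0 < δ := by positivity
  have h2 : ∀ᶠ s in 𝓝[<] t, max a (t - δ) < s :=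
    (lt_mem_nhds (max_lt ht.1 (by linarith))).filter_mono nhdsWithin_le_nhds
  filter_upwards [h1, h2, self_mem_nhdsWithin] with s hs1 hs hst
  have hst' : s < t := hst
  have has : a < s := (le_max_left _ _).trans_lt hs
  have hds : t - δ < s := (le_max_right _ _).trans_lt hs
  have hsI : s ∈ Set.Icc a b := ⟨has.le, hst'.le.trans ht.2⟩
  have hL := norm_sub_le_of_isTest hX hU hsI htI hst'.le
  have hts : 0 < t - s := sub_pos.2 hst'
  have e : ‖U s‖ ^ 2 = ‖U t‖ ^ 2 - 2 * (⟪U t, U t - U s⟫_ℂ).re + ‖U t - U s‖ ^ 2 := by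
    have := norm_sub_sq (𝕜 := ℂ) (U t) (U t - U s)
    rwa [sub_sub_cancel] at this
  have hQ : ‖U t - U s‖ ^ 2 ≤ η / 2 * (t - s) := by
    calc ‖U t - U s‖ ^ 2 ≤ (C * (t - s)) ^ 2 := by gcongr
      _ = C ^ 2 * (t - s) * (t - s) := by ring
      _ ≤ (C ^ 2 + 1) * δ * (t - s) := by
        gcongr
        · linarith
        · linarith
      _ = η / 2 * (t - s) := by rw [hδ]; field_simp
  have hQ0 : 0 ≤ ‖U t - U s‖ ^ 2 := by positivity
  rw [abs_le] at hs1 ⊢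
  constructor <;> nlinarith [hs1.1, hs1.2]

end Hilbert

/-- The Hilbert space of square integrable complex vector fields on `ℝ³`. -/
abbrev L2Field := PiLp 2 (fun _ : Fin 3 => Lp ℂ 2 (volume : Measure (Ell 3)))

/-- The element of `L2Field` with the given components. -/
def mkField (w : Fin 3 → Ell 3 → ℂ) (hw : ∀ l, MemLp (w l) 2 volume) : L2Field :=
  WithLp.toLp 2 fun l => (hw l).toLp (w l)

theorem inner_mkField {w z : Fin 3 → Ell 3 → ℂ} (hw : ∀ l, MemLp (w l) 2 volume)
    (hz : ∀ l, MemLp (z l) 2 volume) :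
    ⟪mkField w hw, mkField z hz⟫_ℂ = ∑ l, ∫ x, conj (w l x) * z l x := by
  rw [PiLp.inner_apply]
  refine Finset.sum_congr rfl fun l _ => ?_
  rw [L2.inner_def]
  refine integral_congr_ae ?_
  filter_upwards [(hw l).coeFn_toLp, (hz l).coeFn_toLp] with x h1 h2
  simp only [mkField]
  rw [h1, h2, RCLike.inner_apply, mul_comm]

theorem norm_mkField_sq {w : Fin 3 → Ell 3 → ℂ} (hw : ∀ l, MemLp (w l) 2 volume) :
    ‖mkField w hw‖ ^ 2 = ∑ l, ∫ x, ‖w l x‖ ^ 2 := by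
  have h := inner_self_eq_norm_sq_to_K (𝕜 := ℂ) (mkField w hw)
  rw [inner_mkField] at h
  have h2 : ∀ l, ∫ x, conj (w l x) * w l x = ((∫ x, ‖w l x‖ ^ 2 : ℝ) : ℂ) := by
    intro l
    rw [← integral_complex_ofReal]
    refine integral_congr_ae (Eventually.of_forall fun x => ?_)
    simp [Complex.conj_mul']
  simp only [h2] at h
  rw [← Complex.ofReal_sum] at h
  have h3 : ((∑ l, ∫ x, ‖w l x‖ ^ 2 : ℝ) : ℂ) = ((‖mkField w hw‖ ^ 2 : ℝ) : ℂ) := by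
    rw [h]; simp
  exact (Complex.ofReal_injective h3).symm

theorem mkField_sub {w z : Fin 3 → Ell 3 → ℂ} (hw : ∀ l, MemLp (w l) 2 volume)
    (hz : ∀ l, MemLp (z l) 2 volume) :
    mkField w hw - mkField z hz = mkField (fun l => w l - z l) (fun l => (hw l).sub (hz l)) := rfl

theorem mkField_congr {w z : Fin 3 → Ell 3 → ℂ} (hw : ∀ l, MemLp (w l) 2 volume)
    (hz : ∀ l, MemLp (z l) 2 volume) (h : w = z) : mkField w hw = mkField z hz := by
  subst h; rfl

theorem mkField_sum {ι : Type*} (s : Finset ι) {w : ι → Fin 3 → Ell 3 → ℂ}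
    (hw : ∀ i l, MemLp (w i l) 2 volume) :
    ∑ i ∈ s, mkField (w i) (hw i) =
      mkField (fun l => ∑ i ∈ s, w i l) (fun l => memLp_finsetSum' s fun i _ => hw i l) := by
  classical
  induction s using Finset.induction_on with
  | empty =>
    simp only [Finset.sum_empty]
    rfl
  | insert i s hi ih =>
    rw [Finset.sum_insert hi, ih]
    have : mkField (w i) (hw i) + mkField (fun l => ∑ i ∈ s, w i l)
        (fun l => memLp_finsetSum' s fun i _ => hw i l) =
        mkField (fun l => w i l + ∑ i ∈ s, w i l)
        (fun l => (hw i l).add (memLp_finsetSum' s fun i _ => hw i l)) := rfl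
    rw [this]
    refine mkField_congr _ _ ?_
    funext l
    rw [Finset.sum_insert hi]

open scoped Topology in
theorem tendsto_mkField {w : ℕ → Fin 3 → Ell 3 → ℂ} {z : Fin 3 → Ell 3 → ℂ}
    (hw : ∀ n l, MemLp (w n l) 2 volume) (hz : ∀ l, MemLp (z l) 2 volume)
    (h : ∀ l, Tendsto (fun n => ∫ x, ‖w n l x - z l x‖ ^ 2) atTop (𝓝 0)) :
    Tendsto (fun n => mkField (w n) (hw n)) atTop (𝓝 (mkField z hz)) := by
  rw [tendsto_iff_norm_sub_tendsto_zero]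
  have h1 : Tendsto (fun n => ‖mkField (w n) (hw n) - mkField z hz‖ ^ 2) atTop (𝓝 0) := by
    simp only [mkField_sub, norm_mkField_sq, Pi.sub_apply]
    simpa using tendsto_finsetSum Finset.univ fun l _ => h l
  have h2 := h1.sqrt
  simpa [Real.sqrt_sq (norm_nonneg _)] using h2

/-- The `L²` field of a Schwartz vector field. -/
def schwartzField (f : Fin 3 → 𝓢(Ell 3, ℂ)) : L2Field :=
  mkField (fun l => f l) (fun l => (f l).memLp 2)

theorem inner_schwartzField_fourier (f g : Fin 3 → 𝓢(Ell 3, ℂ)) :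
    ⟪schwartzField fun l => 𝓕 (f l), schwartzField fun l => 𝓕 (g l)⟫_ℂ =
      ⟪schwartzField f, schwartzField g⟫_ℂ := by
  rw [schwartzField, schwartzField, schwartzField, schwartzField, inner_mkField, inner_mkField]
  refine Finset.sum_congr rfl fun l _ => ?_
  have := SchwartzMap.integral_inner_fourier_fourier (f l) (g l)
  simpa [RCLike.inner_apply, mul_comm] using this

theorem norm_schwartzField_fourier (f : Fin 3 → 𝓢(Ell 3, ℂ)) :
    ‖schwartzField fun l => 𝓕 (f l)‖ = ‖schwartzField f‖ := by
  have h := inner_schwartzField_fourier f f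
  rw [inner_self_eq_norm_sq_to_K, inner_self_eq_norm_sq_to_K] at h
  have h' : ‖schwartzField fun l => 𝓕 (f l)‖ ^ 2 = ‖schwartzField f‖ ^ 2 := by exact_mod_cast h
  exact (sq_eq_sq₀ (norm_nonneg _) (norm_nonneg _)).1 h'

/-- The `i`-th partial derivative of a Schwartz function. -/
def sd (i : Fin 3) (f : 𝓢(Ell 3, ℂ)) : 𝓢(Ell 3, ℂ) := ∂_{eVec 3 i} f

theorem sd_apply (i : Fin 3) (f : 𝓢(Ell 3, ℂ)) (x : Ell 3) :
    sd i f x = fderiv ℝ f x (eVec 3 i) :=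
  SchwartzMap.lineDerivOp_apply_eq_fderiv _ _ _

theorem inner_eVec (ξ : Ell 3) (i : Fin 3) : inner ℝ ξ (eVec 3 i) = ξ i := by
  simp [eVec, EuclideanSpace.inner_single_right]

theorem fourier_sd (i : Fin 3) (f : 𝓢(Ell 3, ℂ)) (ξ : Ell 3) :
    𝓕 (sd i f) ξ = 2 * Real.pi * Complex.I * ξ i * 𝓕 f ξ := by
  rw [sd, SchwartzMap.fourier_lineDerivOp_eq, _root_.smul_apply,
    SchwartzMap.smulLeftCLM_apply_apply (by fun_prop), inner_eVec]
  simp only [smul_eq_mul, Complex.real_smul]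
  ring

theorem fourier_laplacian (f : 𝓢(Ell 3, ℂ)) (ξ : Ell 3) :
    𝓕 (Δ f) ξ = -(4 * Real.pi ^ 2 * ‖ξ‖ ^ 2 : ℝ) * 𝓕 f ξ := by
  rw [SchwartzMap.laplacian_eq_fourierMultiplierCLM, FourierTransform.fourier_smul,
    SchwartzMap.fourierMultiplierCLM_apply, FourierTransform.fourier_fourierInv_eq,
    _root_.smul_apply, SchwartzMap.smulLeftCLM_apply_apply (by fun_prop)]
  simp only [Complex.real_smul]
  push_cast
  ring

theorem laplacian_apply_eq_sum (f : 𝓢(Ell 3, ℂ)) (x : Ell 3) :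
    (Δ f) x = ∑ i, sd i (sd i f) x := by
  rw [SchwartzMap.laplacian_eq_sum (EuclideanSpace.basisFun (Fin 3) ℝ) f, _root_.sum_apply]
  simp [sd, eVec]

/-- Pointwise product of Schwartz functions. -/
def smulS (f g : 𝓢(Ell 3, ℂ)) : 𝓢(Ell 3, ℂ) := SchwartzMap.pairing (.mul ℂ ℂ) f g

@[simp] theorem smulS_apply (f g : 𝓢(Ell 3, ℂ)) (x : Ell 3) : smulS f g x = f x * g x := rfl

/-- The advection term `(V·∇)V` of a Schwartz vector field. -/
def advS (V : Fin 3 → 𝓢(Ell 3, ℂ)) (l : Fin 3) : 𝓢(Ell 3, ℂ) := ∑ i, smulS (V i) (sd i (V l))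

theorem advS_apply (V : Fin 3 → 𝓢(Ell 3, ℂ)) (l : Fin 3) (x : Ell 3) :
    advS V l x = ∑ i, V i x * sd i (V l) x := by
  simp [advS]

/-- The pressureless right-hand side `ΔV - (V·∇)V`. -/
def rhsS (V : Fin 3 → 𝓢(Ell 3, ℂ)) (l : Fin 3) : 𝓢(Ell 3, ℂ) := Δ (V l) - advS V l

open Set in
/-- Integrated form of `∂ₜA = R` against a compactly supported function. -/
theorem integral_time_increment {T : ℝ} {A : ℝ → Ell 3 → ℂ} {R : ℝ → Ell 3 → ℂ}
    (hR : ContinuousOn R.uncurry (Ico 0 T ×ˢ univ))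
    (hA : ∀ t ∈ Ico 0 T, ∀ x, HasDerivWithinAt (fun s => A s x) (R t x) (Ico 0 T) t)
    {φ : Ell 3 → ℂ} (hφ : Continuous φ) (hφc : HasCompactSupport φ) :
    ContinuousOn (fun r => ∫ x, R r x * φ x) (Ico 0 T) ∧
      ∀ s ∈ Ico 0 T, ∀ t ∈ Ico 0 T, s ≤ t →
        ∫ x, (A t x - A s x) * φ x = ∫ r in s..t, ∫ x, R r x * φ x := by
  have hf : ContinuousOn (Function.uncurry fun r x => R r x * φ x) (Ico 0 T ×ˢ univ) :=
    hR.mul (hφ.comp continuous_snd).continuousOn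
  have hz : ∀ (r : ℝ) (x : Ell 3), x ∉ tsupport φ → R r x * φ x = 0 := fun r x hx => by
    rw [image_eq_zero_of_notMem_tsupport hx, mul_zero]
  refine ⟨continuousOn_integral_of_compact_support hφc hf fun r x _ hx => hz r x hx, ?_⟩
  intro s hs t ht hst
  have hsub : Icc s t ⊆ Ico 0 T := fun r hr => ⟨hs.1.trans hr.1, hr.2.trans_lt ht.2⟩
  have hpt : ∀ x, A t x - A s x = ∫ r in s..t, R r x := by
    intro x
    rw [intervalIntegral.integral_eq_sub_of_hasDeriv_right_of_le hst]
    · exact fun r hr => ((hA r (hsub hr) x).continuousWithinAt).mono hsub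
    · intro r hr
      have hr' := hsub (Ioo_subset_Icc_self hr)
      refine ((hA r hr' x).hasDerivAt (Ico_mem_nhds ?_ hr'.2)).hasDerivWithinAt
      exact hs.1.trans_lt hr.1
    · refine ContinuousOn.intervalIntegrable ?_
      rw [uIcc_of_le hst]
      exact hR.comp (Continuous.prodMk_left x).continuousOn fun r hr => ⟨hsub hr, mem_univ _⟩
  have hint : Integrable (Function.uncurry fun r x => R r x * φ x)
      ((volume.restrict (Ioc s t)).prod volume) := by
    have h1 : IntegrableOn (Function.uncurry fun r x => R r x * φ x)
        (Icc s t ×ˢ tsupport φ) (volume.prod volume) :=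
      (hf.mono (prod_mono hsub (subset_univ _))).integrableOn_compact
        (isCompact_Icc.prod hφc.isCompact)
    have h2 : IntegrableOn (Function.uncurry fun r x => R r x * φ x)
        (Ioc s t ×ˢ univ) (volume.prod volume) := by
      refine h1.of_forall_sdiff_eq_zero (measurableSet_Ioc.prod MeasurableSet.univ) ?_
      rintro ⟨r, x⟩ ⟨h1, h2⟩
      refine hz r x fun hx => h2 ⟨Ioc_subset_Icc_self h1.1, hx⟩
    rw [IntegrableOn, ← Measure.prod_restrict, Measure.restrict_univ] at h2
    exact h2
  rw [intervalIntegral.integral_of_le hst, integral_integral_swap hint]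
  refine integral_congr_ae (Eventually.of_forall fun x => ?_)
  simp only
  rw [hpt x, intervalIntegral.integral_of_le hst, integral_mul_const]

/-- A gradient pairs to zero with a compactly supported rotated gradient. -/
theorem integral_gradient_curl_eq_zero {p g : Ell 3 → ℂ} (hp : ContDiff ℝ (⊤ : ℕ∞) p)
    (hg : ContDiff ℝ (⊤ : ℕ∞) g) (hgc : HasCompactSupport g) (v w : Ell 3) :
    ∫ x, (fderiv ℝ p x v * fderiv ℝ g x w - fderiv ℝ p x w * fderiv ℝ g x v) = 0 := by
  have hdp : ∀ v, ContDiff ℝ (⊤ : ℕ∞) fun x => fderiv ℝ p x v := fun v =>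
    (hp.fderiv_right (m := (⊤ : ℕ∞)) (by simp)).clm_apply contDiff_const
  have hdg : ∀ v, ContDiff ℝ (⊤ : ℕ∞) fun x => fderiv ℝ g x v := fun v =>
    (hg.fderiv_right (m := (⊤ : ℕ∞)) (by simp)).clm_apply contDiff_const
  have hdgc : ∀ v, HasCompactSupport fun x => fderiv ℝ g x v := fun v => hgc.fderiv_apply ℝ v
  have hi : ∀ {a b : Ell 3 → ℂ}, Continuous a → Continuous b → HasCompactSupport b →
      Integrable fun x => a x * b x := fun ha hb hc =>
    (ha.mul hb).integrable_of_hasCompactSupport hc.mul_left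
  have ibp : ∀ v w, ∫ x, fderiv ℝ p x v * fderiv ℝ g x w =
      - ∫ x, fderiv ℝ (fun y => fderiv ℝ p y v) x w * g x := by
    intro v w
    refine integral_mul_fderiv_eq_neg_fderiv_mul_of_integrable ?_ ?_ ?_ ?_ ?_
    · exact hi (((hdp v).continuous_fderiv (by simp)).clm_apply continuous_const) hg.continuous hgc
    · exact hi (hdp v).continuous (hdg w).continuous (hdgc w)
    · exact hi (hdp v).continuous hg.continuous hgc
    · exact fun x _ => (hdp v).differentiable (by simp) x
    · exact fun x _ => hg.differentiable (by simp) x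
  rw [integral_sub (hi (hdp v).continuous (hdg w).continuous (hdgc w))
    (hi (hdp w).continuous (hdg v).continuous (hdgc v)), ibp, ibp, sub_eq_zero]
  congr 2
  funext x
  congr 1
  have hdd : DifferentiableAt ℝ (fderiv ℝ p) x :=
    (hp.fderiv_right (m := (⊤ : ℕ∞)) (by simp)).differentiable (by simp) x
  rw [fderiv_clm_apply hdd (differentiableAt_const _), fderiv_clm_apply hdd (differentiableAt_const _)]
  have hs : IsSymmSndFDerivAt ℝ p x := (hp.contDiffAt).isSymmSndFDerivAt (by
    simp only [minSmoothness_of_isRCLikeNormedField]; exact WithTop.coe_le_coe.2 (le_top : (2 : ℕ∞) ≤ ⊤))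
  simpa using hs.eq w v

/-- The complex Schwartz function underlying a real one. -/
def cxS (f : 𝓢(Ell 3, ℝ)) : 𝓢(Ell 3, ℂ) := postcompCLM Complex.ofRealCLM f

@[simp] theorem cxS_apply (f : 𝓢(Ell 3, ℝ)) (x : Ell 3) : cxS f x = (f x : ℂ) := rfl

theorem fderiv_ofReal_comp {f : Ell 3 → ℝ} {x : Ell 3} (hf : DifferentiableAt ℝ f x) (v : Ell 3) :
    fderiv ℝ (fun y => (f y : ℂ)) x v = (fderiv ℝ f x v : ℂ) := by
  have := (Complex.ofRealCLM.hasFDerivAt.comp x hf.hasFDerivAt).fderiv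
  have h2 : (⇑Complex.ofRealCLM ∘ f) = fun y => (f y : ℂ) := rfl
  rw [h2] at this
  rw [this]; rfl

theorem sd_cxS (i : Fin 3) (f : 𝓢(Ell 3, ℝ)) (x : Ell 3) :
    sd i (cxS f) x = (fderiv ℝ f x (eVec 3 i) : ℂ) := by
  rw [sd_apply]
  exact fderiv_ofReal_comp f.differentiableAt _

theorem sd_sd_cxS (i j : Fin 3) (f : 𝓢(Ell 3, ℝ)) (x : Ell 3) :
    sd j (sd i (cxS f)) x = (fderiv ℝ (fun y => fderiv ℝ f y (eVec 3 i)) x (eVec 3 j) : ℂ) := by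
  rw [sd_apply]
  have : (⇑(sd i (cxS f)) : Ell 3 → ℂ) = fun y => ((fderiv ℝ f y (eVec 3 i) : ℝ) : ℂ) :=
    funext fun y => sd_cxS i f y
  rw [this]
  refine fderiv_ofReal_comp ?_ _
  have h1 : ContDiff ℝ 1 fun y => fderiv ℝ f y (eVec 3 i) :=
    ((f.smooth (⊤ : ℕ∞)).fderiv_right (m := (⊤ : ℕ∞)) (by simp)).clm_apply contDiff_const |>.of_le
      (mod_cast le_top)
  exact h1.differentiable (by simp) x

/-- `v` parametrizes the time slices of the velocity by Schwartz vector fields. -/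
def IsSlices (T : ℝ) (u : ℝ → Ell 3 → Fin 3 → ℝ) (v : ℝ → Fin 3 → 𝓢(Ell 3, ℝ)) : Prop :=
  ∀ t ∈ Set.Ico (0 : ℝ) T, ∀ l x, u t x l = v t l x

theorem IsNSSolution.exists_slices {T : ℝ} {u : ℝ → Ell 3 → Fin 3 → ℝ} {p : ℝ → Ell 3 → ℝ}
    (h : IsNSSolution T u p) : ∃ v, IsSlices T u v := by
  classical
  have h3 := h.2.2.1
  choose! f hf using h3
  exact ⟨f, fun t ht l x => hf t ht l x⟩

section Solution

variable {T : ℝ} {u : ℝ → Ell 3 → Fin 3 → ℝ} {p : ℝ → Ell 3 → ℝ}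
  {v : ℝ → Fin 3 → 𝓢(Ell 3, ℝ)}

theorem IsNSSolution.hasDerivWithinAt_slices (h : IsNSSolution T u p) (hv : IsSlices T u v)
    {t : ℝ} (ht : t ∈ Set.Ico 0 T) (x : Ell 3) (l : Fin 3) :
    HasDerivWithinAt (fun s => ((u s x l : ℝ) : ℂ))
      (rhsS (fun i => cxS (v t i)) l x - fderiv ℝ (fun z => ((p t z : ℝ) : ℂ)) x (eVec 3 l))
      (Set.Ico 0 T) t := by
  have h5 := (h.2.2.2.2 t ht x l).ofReal_comp
  convert h5 using 1
  have hpd : DifferentiableAt ℝ (fun z => p t z) x := by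
    have h2 : ContDiff ℝ (⊤ : ℕ∞) (fun z => p t z) := by
      rw [← contDiffOn_univ]
      exact h.2.1.comp (contDiff_prodMk_right t).contDiffOn fun z _ => ⟨ht, Set.mem_univ _⟩
    exact h2.differentiable (by simp) x
  rw [fderiv_ofReal_comp hpd, rhsS, _root_.sub_apply, laplacian_apply_eq_sum, advS_apply]
  simp only [sd_sd_cxS, sd_cxS, cxS_apply, hv t ht]
  push_cast
  rfl

theorem IsNSSolution.contDiff_pressure (h : IsNSSolution T u p) {t : ℝ} (ht : t ∈ Set.Ico 0 T) :
    ContDiff ℝ (⊤ : ℕ∞) (fun z => ((p t z : ℝ) : ℂ)) := by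
  have h2 : ContDiff ℝ (⊤ : ℕ∞) (fun z => p t z) := by
    rw [← contDiffOn_univ]
    exact h.2.1.comp (contDiff_prodMk_right t).contDiffOn fun z _ => ⟨ht, Set.mem_univ _⟩
  exact Complex.ofRealCLM.contDiff.comp h2

theorem IsNSSolution.continuousOn_timeDeriv (h : IsNSSolution T u p) (hv : IsSlices T u v)
    (l : Fin 3) :
    ContinuousOn (Function.uncurry fun t x => rhsS (fun i => cxS (v t i)) l x -
      fderiv ℝ (fun z => ((p t z : ℝ) : ℂ)) x (eVec 3 l)) (Set.Ico 0 T ×ˢ Set.univ) := by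
  set S : Set (ℝ × Ell 3) := Set.Ico 0 T ×ˢ Set.univ with hS
  rcases le_or_gt T 0 with hT | hT
  · have : S = ∅ := by simp [hS, Set.Ico_eq_empty (not_lt.2 hT)]
    rw [this]; exact continuousOn_empty _
  have hud : UniqueDiffOn ℝ S := (uniqueDiffOn_Ico 0 T).prod uniqueDiffOn_univ
  set A : ℝ × Ell 3 → ℂ := fun q => ((u q.1 q.2 l : ℝ) : ℂ) with hA
  have hAc : ContDiffOn ℝ (⊤ : ℕ∞) A S := Complex.ofRealCLM.contDiff.comp_contDiffOn (h.1 l)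
  have hc : ContinuousOn (fun q => fderivWithin ℝ A S q (1, 0)) S :=
    (hAc.continuousOn_fderivWithin hud (by simp)).clm_apply continuousOn_const
  refine hc.congr ?_
  rintro ⟨t, x⟩ ⟨ht, -⟩
  have hd := (hAc.differentiableOn (by simp) (t, x) ⟨ht, Set.mem_univ _⟩).hasFDerivWithinAt
  have hline : HasDerivWithinAt (fun s : ℝ => ((s, x) : ℝ × Ell 3)) (1, 0) (Set.Ico 0 T) t :=
    (hasDerivWithinAt_id t _).prodMk (hasDerivWithinAt_const _ _ _)
  have h1 := hd.comp_hasDerivWithinAt t hline (show Set.MapsTo _ _ S from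
    fun s hs => ⟨hs, Set.mem_univ _⟩)
  exact (uniqueDiffOn_Ico 0 T t ht).eq_deriv _ (h.hasDerivWithinAt_slices hv ht x l) h1

/-- Pressure-free weak form of the momentum equation against compactly supported tests. -/
theorem IsNSSolution.weak_form_compact (h : IsNSSolution T u p) (hv : IsSlices T u v)
    {g : Ell 3 → ℂ} (hg : ContDiff ℝ (⊤ : ℕ∞) g) (hgc : HasCompactSupport g) (l m : Fin 3) :
    ContinuousOn (fun r => (∫ x, rhsS (fun i => cxS (v r i)) l x * fderiv ℝ g x (eVec 3 m)) -
        ∫ x, rhsS (fun i => cxS (v r i)) m x * fderiv ℝ g x (eVec 3 l)) (Set.Ico 0 T) ∧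
      ∀ s ∈ Set.Ico 0 T, ∀ t ∈ Set.Ico 0 T, s ≤ t →
        (∫ x, (cxS (v t l) x - cxS (v s l) x) * fderiv ℝ g x (eVec 3 m)) -
          (∫ x, (cxS (v t m) x - cxS (v s m) x) * fderiv ℝ g x (eVec 3 l)) =
        ∫ r in s..t, ((∫ x, rhsS (fun i => cxS (v r i)) l x * fderiv ℝ g x (eVec 3 m)) -
          ∫ x, rhsS (fun i => cxS (v r i)) m x * fderiv ℝ g x (eVec 3 l)) := by
  have hdg : ∀ w, Continuous fun x => fderiv ℝ g x w := fun w =>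
    (hg.continuous_fderiv (by simp)).clm_apply continuous_const
  have hdgc : ∀ w, HasCompactSupport fun x => fderiv ℝ g x w := fun w => hgc.fderiv_apply ℝ w
  have key := fun l m => integral_time_increment (h.continuousOn_timeDeriv hv l)
    (fun t ht x => h.hasDerivWithinAt_slices hv ht x l) (hdg (eVec 3 m)) (hdgc (eVec 3 m))
  have hi : ∀ {a : Ell 3 → ℂ}, Continuous a → ∀ w, Integrable fun x => a x * fderiv ℝ g x w :=
    fun ha w => (ha.mul (hdg w)).integrable_of_hasCompactSupport (hdgc w).mul_left
  have hpc : ∀ r ∈ Set.Ico 0 T, ∀ w,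
      Continuous fun x => fderiv ℝ (fun z => ((p r z : ℝ) : ℂ)) x w := fun r hr w =>
    ((h.contDiff_pressure hr).continuous_fderiv (by simp)).clm_apply continuous_const
  have hF : ∀ r ∈ Set.Ico 0 T,
      (∫ x, (rhsS (fun i => cxS (v r i)) l x -
        fderiv ℝ (fun z => ((p r z : ℝ) : ℂ)) x (eVec 3 l)) * fderiv ℝ g x (eVec 3 m)) -
      (∫ x, (rhsS (fun i => cxS (v r i)) m x -
        fderiv ℝ (fun z => ((p r z : ℝ) : ℂ)) x (eVec 3 m)) * fderiv ℝ g x (eVec 3 l)) =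
      (∫ x, rhsS (fun i => cxS (v r i)) l x * fderiv ℝ g x (eVec 3 m)) -
        ∫ x, rhsS (fun i => cxS (v r i)) m x * fderiv ℝ g x (eVec 3 l) := by
    intro r hr
    have h0 := integral_gradient_curl_eq_zero (h.contDiff_pressure hr) hg hgc
      (eVec 3 l) (eVec 3 m)
    rw [integral_sub (hi (hpc r hr _) _) (hi (hpc r hr _) _)] at h0
    simp only [sub_mul]
    rw [integral_sub (hi (SchwartzMap.continuous _) _) (hi (hpc r hr _) _),
      integral_sub (hi (SchwartzMap.continuous _) _) (hi (hpc r hr _) _)]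
    linear_combination -h0
  refine ⟨((key l m).1.sub (key m l).1).congr fun r hr => (hF r hr).symm, ?_⟩
  intro s hs t ht hst
  have hsub : Set.uIcc s t ⊆ Set.Ico 0 T := by
    rw [Set.uIcc_of_le hst]; exact fun r hr => ⟨hs.1.trans hr.1, hr.2.trans_lt ht.2⟩
  rw [← intervalIntegral.integral_congr fun r hr => hF r (hsub hr),
    intervalIntegral.integral_sub ((key l m).1.mono hsub).intervalIntegrable
      ((key m l).1.mono hsub).intervalIntegrable,
    ← (key l m).2 s hs t ht hst, ← (key m l).2 s hs t ht hst]
  simp only [cxS_apply, hv t ht, hv s hs]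

end Solution

/-- Multiplication of a Schwartz function by a real function of temperate growth. -/
def rmulS (ρ : Ell 3 → ℝ) (f : 𝓢(Ell 3, ℂ)) : 𝓢(Ell 3, ℂ) := smulLeftCLM ℂ ρ f

theorem rmulS_apply {ρ : Ell 3 → ℝ} (hρ : ρ.HasTemperateGrowth) (f : 𝓢(Ell 3, ℂ)) (x : Ell 3) :
    rmulS ρ f x = (ρ x : ℂ) * f x := by
  rw [rmulS, SchwartzMap.smulLeftCLM_apply_apply hρ, Complex.real_smul]

theorem hasTemperateGrowth_coord (i : Fin 3) :
    (fun ξ : Ell 3 => ξ i).HasTemperateGrowth := by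
  simp only [← inner_eVec]
  fun_prop

/-- The rotated gradient `∂ₘg e_l - ∂ₗg e_m`. -/
def rotS (g : 𝓢(Ell 3, ℂ)) (l m : Fin 3) : Fin 3 → 𝓢(Ell 3, ℂ) :=
  Pi.single l (sd m g) - Pi.single m (sd l g)

theorem inner_schwartzField_single (f : 𝓢(Ell 3, ℂ)) (l : Fin 3) (z : Fin 3 → 𝓢(Ell 3, ℂ)) :
    ⟪schwartzField (Pi.single l f), schwartzField z⟫_ℂ = ∫ x, conj (f x) * z l x := by
  rw [schwartzField, schwartzField, inner_mkField, Finset.sum_eq_single l]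
  · simp
  · intro j _ hj
    simp [Pi.single_eq_of_ne hj]
  · simp

theorem schwartzField_sub (f g : Fin 3 → 𝓢(Ell 3, ℂ)) :
    schwartzField (f - g) = schwartzField f - schwartzField g := rfl

theorem inner_rotS (g : 𝓢(Ell 3, ℂ)) (l m : Fin 3) (z : Fin 3 → 𝓢(Ell 3, ℂ)) :
    ⟪schwartzField (rotS g l m), schwartzField z⟫_ℂ =
      (∫ x, z l x * conj (sd m g x)) - ∫ x, z m x * conj (sd l g x) := by
  rw [rotS, schwartzField_sub, inner_sub_left, inner_schwartzField_single,
    inner_schwartzField_single]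
  simp only [mul_comm]

theorem fderiv_conj_comp (g : 𝓢(Ell 3, ℂ)) (x : Ell 3) (i : Fin 3) :
    fderiv ℝ (fun y => conj (g y)) x (eVec 3 i) = conj (sd i g x) := by
  rw [sd_apply]
  have := (Complex.conjCLE.toContinuousLinearMap.hasFDerivAt.comp x
    g.differentiableAt.hasFDerivAt).fderiv
  have h2 : (⇑Complex.conjCLE.toContinuousLinearMap ∘ ⇑g) = fun y => conj (g y) := rfl
  rw [h2] at this
  rw [this]; rfl

open scoped Topology in
/-- Schwartz functions are approximated by compactly supported ones, with convergence of the
gradients in `L²`. -/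
theorem exists_compactSupport_approx (g : 𝓢(Ell 3, ℂ)) :
    ∃ G : ℕ → 𝓢(Ell 3, ℂ), (∀ n, HasCompactSupport (G n)) ∧
      ∀ i, Tendsto (fun n => ∫ x, ‖sd i (G n) x - sd i g x‖ ^ 2) atTop (𝓝 0) := by
  let χ : ContDiffBump (0 : Ell 3) := ⟨1, 2, by norm_num, by norm_num⟩
  have hχ : ContDiff ℝ (⊤ : ℕ∞) (χ : Ell 3 → ℝ) := χ.contDiff
  have hχc : HasCompactSupport (χ : Ell 3 → ℝ) := χ.hasCompactSupport
  obtain ⟨C, hC⟩ := (hχc.fderiv ℝ).exists_bound_of_continuous (hχ.continuous_fderiv (by simp))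
  have hC0 : 0 ≤ C := (norm_nonneg _).trans (hC 0)
  have hscale : ∀ n : ℕ, ContDiff ℝ (⊤ : ℕ∞) fun x : Ell 3 => ((χ (((n : ℝ) + 1)⁻¹ • x) : ℝ) : ℂ) :=
    fun n => Complex.ofRealCLM.contDiff.comp (hχ.comp (contDiff_const_smul _))
  have hscalec : ∀ n : ℕ, HasCompactSupport fun x : Ell 3 => ((χ (((n : ℝ) + 1)⁻¹ • x) : ℝ) : ℂ) := by
    intro n
    have h1 : HasCompactSupport fun x : Ell 3 => χ (((n : ℝ) + 1)⁻¹ • x) :=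
      hχc.comp_homeomorph (Homeomorph.smulOfNeZero (((n : ℝ) + 1)⁻¹) (by positivity))
    exact h1.comp_left (g := fun r : ℝ => (r : ℂ)) (by simp)
  let X : ℕ → 𝓢(Ell 3, ℂ) := fun n => (hscalec n).toSchwartzMap (hscale n)
  have hX : ∀ n x, X n x = ((χ (((n : ℝ) + 1)⁻¹ • x) : ℝ) : ℂ) := fun n x => rfl
  have hdX : ∀ n i x, ‖sd i (X n) x‖ ≤ C * ((n : ℝ) + 1)⁻¹ := by
    intro n i x
    rw [sd_apply]
    have e : (⇑(X n) : Ell 3 → ℂ) = fun y => ((χ (((n : ℝ) + 1)⁻¹ • y) : ℝ) : ℂ) := rfl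
    have hd1 : HasFDerivAt (fun y : Ell 3 => χ (((n : ℝ) + 1)⁻¹ • y))
        ((fderiv ℝ χ (((n : ℝ) + 1)⁻¹ • x)).comp
          (((n : ℝ) + 1)⁻¹ • ContinuousLinearMap.id ℝ (Ell 3))) x :=
      ((hχ.differentiable (by simp) _).hasFDerivAt).comp x
        ((hasFDerivAt_id x).const_smul (((n : ℝ) + 1)⁻¹))
    rw [e, fderiv_ofReal_comp hd1.differentiableAt, hd1.fderiv, Complex.norm_real]
    have hn : (0 : ℝ) ≤ ((n : ℝ) + 1)⁻¹ := by positivity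
    calc ‖((fderiv ℝ χ (((n : ℝ) + 1)⁻¹ • x)).comp
          (((n : ℝ) + 1)⁻¹ • ContinuousLinearMap.id ℝ (Ell 3))) (eVec 3 i)‖
        = ‖fderiv ℝ χ (((n : ℝ) + 1)⁻¹ • x) (((n : ℝ) + 1)⁻¹ • eVec 3 i)‖ := by simp
      _ ≤ C * ‖((n : ℝ) + 1)⁻¹ • eVec 3 i‖ := (ContinuousLinearMap.le_opNorm _ _).trans (by
          gcongr; exact hC _)
      _ = C * ((n : ℝ) + 1)⁻¹ := by
          rw [norm_smul, Real.norm_of_nonneg hn]; simp [eVec]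
  have h1X : ∀ n x, ‖X n x - 1‖ ≤ ‖x‖ * ((n : ℝ) + 1)⁻¹ := by
    intro n x
    have hn : (0 : ℝ) < (n : ℝ) + 1 := by positivity
    rw [hX, ← Complex.ofReal_one, ← Complex.ofReal_sub, Complex.norm_real, Real.norm_eq_abs]
    by_cases hx : ‖x‖ ≤ (n : ℝ) + 1
    · have : χ (((n : ℝ) + 1)⁻¹ • x) = 1 := by
        apply χ.one_of_mem_closedBall
        rw [mem_closedBall_zero_iff, norm_smul, Real.norm_of_nonneg (by positivity)]
        show _ ≤ (1 : ℝ)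
        rw [inv_mul_le_iff₀ hn]; linarith
      rw [this]; simp; positivity
    · push Not at hx
      have h2 : 1 ≤ ‖x‖ * ((n : ℝ) + 1)⁻¹ := by
        rw [← div_eq_mul_inv, le_div_iff₀ hn]; linarith
      have h3 := χ.nonneg (x := ((n : ℝ) + 1)⁻¹ • x)
      have h4 := χ.le_one (x := ((n : ℝ) + 1)⁻¹ • x)
      rw [abs_le]; constructor <;> linarith
  refine ⟨fun n => smulS (X n) g, fun n => ?_, fun i => ?_⟩
  · have : HasCompactSupport (⇑(X n)) := hscalec n
    exact this.mul_right
  set F := rmulS (fun x => 1 + ‖x‖ ^ 2) (sd i g) with hF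
  have hFa : ∀ x, ‖F x‖ = (1 + ‖x‖ ^ 2) * ‖sd i g x‖ := by
    intro x
    rw [hF, rmulS_apply (by fun_prop), norm_mul, Complex.norm_real,
      Real.norm_of_nonneg (by positivity)]
  set K : Ell 3 → ℝ := fun x => ‖F x‖ + C * ‖g x‖ with hK
  have hKi : Integrable fun x => K x ^ 2 :=
    ((F.memLp 2).norm.add ((g.memLp 2).norm.const_mul C)).integrable_sq
  have hpt : ∀ n x, ‖sd i (smulS (X n) g) x - sd i g x‖ ^ 2 ≤ (((n : ℝ) + 1)⁻¹) ^ 2 * K x ^ 2 := by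
    intro n x
    have e : sd i (smulS (X n) g) x = X n x * sd i g x + sd i (X n) x * g x := by
      rw [sd_apply, sd_apply, sd_apply]
      have : (⇑(smulS (X n) g) : Ell 3 → ℂ) = fun y => X n y * g y := rfl
      rw [this, fderiv_fun_mul (X n).differentiableAt g.differentiableAt]
      simp [mul_comm]
    rw [← mul_pow]
    gcongr
    have e2 : X n x * sd i g x + sd i (X n) x * g x - sd i g x =
      (X n x - 1) * sd i g x + sd i (X n) x * g x := by ring
    rw [e, e2]
    have hx : ‖x‖ ≤ 1 + ‖x‖ ^ 2 := by nlinarith [sq_nonneg (‖x‖ - 1)]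
    calc _ ≤ ‖X n x - 1‖ * ‖sd i g x‖ + ‖sd i (X n) x‖ * ‖g x‖ := by
          refine (norm_add_le _ _).trans ?_
          rw [norm_mul, norm_mul]
      _ ≤ ((1 + ‖x‖ ^ 2) * ((n : ℝ) + 1)⁻¹) * ‖sd i g x‖ + (C * ((n : ℝ) + 1)⁻¹) * ‖g x‖ := by
          gcongr
          · exact (h1X n x).trans (by gcongr)
          · exact hdX n i x
      _ = ((n : ℝ) + 1)⁻¹ * K x := by rw [hK]; simp only [hFa]; ring
  refine squeeze_zero (fun n => integral_nonneg fun x => by positivity)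
    (fun n => (integral_mono_of_nonneg (Eventually.of_forall fun x => by positivity)
      (hKi.const_mul _) (Eventually.of_forall (hpt n)))) ?_
  simp only [integral_const_mul]
  have h0 : Tendsto (fun n : ℕ => ((n : ℝ) + 1)⁻¹) atTop (𝓝 0) := by
    simpa [one_div] using tendsto_one_div_add_atTop_nhds_zero_nat (𝕜 := ℝ)
  simpa using (h0.pow 2).mul_const (∫ x, K x ^ 2)

theorem rpow_le_one_add_sq {κ : ℝ} (hκ : 0 ≤ κ) (ξ : Ell 3) :
    ‖ξ‖ ^ (2 * κ) ≤ (1 + ‖ξ‖ ^ 2) ^ κ := by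
  rw [Real.rpow_mul (norm_nonneg _)]
  gcongr
  rw [Real.rpow_two]; linarith

theorem memLp_weight {κ : ℝ} (hκ : 0 ≤ κ) (f : 𝓢(Ell 3, ℂ)) :
    MemLp (fun ξ => ((‖ξ‖ ^ (2 * κ) : ℝ) : ℂ) * f ξ) 2 volume := by
  have hg : (fun ξ : Ell 3 => (1 + ‖ξ‖ ^ 2) ^ κ).HasTemperateGrowth :=
    Function.hasTemperateGrowth_one_add_norm_sq_rpow (Ell 3) _
  have hm : MemLp (rmulS (fun ξ : Ell 3 => (1 + ‖ξ‖ ^ 2) ^ κ) f) 2 volume :=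
    (rmulS _ f).memLp 2
  refine hm.mono ?_ ?_
  · refine Continuous.aestronglyMeasurable ?_
    have : Continuous fun ξ : Ell 3 => ‖ξ‖ ^ (2 * κ) :=
      continuous_norm.rpow_const fun x => Or.inr (by linarith)
    exact (Complex.continuous_ofReal.comp this).mul f.continuous
  · refine Eventually.of_forall fun ξ => ?_
    rw [rmulS_apply hg, norm_mul, norm_mul, Complex.norm_real, Complex.norm_real,
      Real.norm_of_nonneg (by positivity), Real.norm_of_nonneg (by positivity)]
    gcongr
    exact rpow_le_one_add_sq hκ ξ

/-- The field `|ξ|^{2κ} k`. -/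
def weightField {κ : ℝ} (hκ : 0 ≤ κ) (k : Fin 3 → 𝓢(Ell 3, ℂ)) : L2Field :=
  mkField (fun l ξ => ((‖ξ‖ ^ (2 * κ) : ℝ) : ℂ) * k l ξ) fun l => memLp_weight hκ (k l)

/-- The Fourier transform of the velocity, as an `L²` field. -/
def velF (v : ℝ → Fin 3 → 𝓢(Ell 3, ℝ)) (t : ℝ) : L2Field :=
  schwartzField fun l => 𝓕 (cxS (v t l))

/-- The Fourier transform of the pressureless right-hand side, as an `L²` field. -/
def rhsF (v : ℝ → Fin 3 → 𝓢(Ell 3, ℝ)) (t : ℝ) : L2Field :=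
  schwartzField fun l => 𝓕 (rhsS (fun i => cxS (v t i)) l)

theorem isTest_fourier_iff {v : ℝ → Fin 3 → 𝓢(Ell 3, ℝ)} {a b : ℝ} (w : Fin 3 → 𝓢(Ell 3, ℂ)) :
    IsTest (velF v) (rhsF v) a b (schwartzField fun l => 𝓕 (w l)) ↔
      IsTest (fun t => schwartzField fun l => cxS (v t l))
        (fun t => schwartzField (rhsS fun i => cxS (v t i))) a b (schwartzField w) := by
  simp only [IsTest, velF, rhsF, inner_sub_right]
  simp only [inner_schwartzField_fourier]

section Solution

variable {T : ℝ} {u : ℝ → Ell 3 → Fin 3 → ℝ} {p : ℝ → Ell 3 → ℝ}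
  {v : ℝ → Fin 3 → 𝓢(Ell 3, ℝ)} {a b C : ℝ}

theorem IsNSSolution.isTest_rotS_compact (h : IsNSSolution T u p) (hv : IsSlices T u v)
    (ha : 0 ≤ a) (hb : b < T) {g : 𝓢(Ell 3, ℂ)} (hg : HasCompactSupport g) (l m : Fin 3) :
    IsTest (fun t => schwartzField fun l => cxS (v t l))
      (fun t => schwartzField (rhsS fun i => cxS (v t i))) a b (schwartzField (rotS g l m)) := by
  have hsub : Set.Icc a b ⊆ Set.Ico 0 T := fun r hr => ⟨ha.trans hr.1, hr.2.trans_lt hb⟩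
  have hcd : ContDiff ℝ (⊤ : ℕ∞) fun y => conj (g y) :=
    Complex.conjCLE.toContinuousLinearMap.contDiff.comp (g.smooth _)
  have hcc : HasCompactSupport fun y => conj (g y) := hg.comp_left (g := conj) (by simp)
  have key := h.weak_form_compact hv hcd hcc l m
  simp only [fderiv_conj_comp] at key
  refine ⟨?_, fun s hs t ht hst => ?_⟩
  · simp only [inner_rotS]
    exact key.1.mono hsub
  · have e : (schwartzField fun l => cxS (v t l)) - (schwartzField fun l => cxS (v s l)) =
        schwartzField fun l => cxS (v t l) - cxS (v s l) := rfl
    simp only [e, inner_rotS]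
    exact key.2 s (hsub hs) t (hsub ht) hst

theorem norm_rhsF (v : ℝ → Fin 3 → 𝓢(Ell 3, ℝ)) (t : ℝ) :
    ‖rhsF v t‖ = ‖schwartzField (rhsS fun i => cxS (v t i))‖ :=
  norm_schwartzField_fourier _

theorem IsNSSolution.isTest_rotS (h : IsNSSolution T u p) (hv : IsSlices T u v)
    (ha : 0 ≤ a) (hb : b < T) (hX : ∀ r ∈ Set.Icc a b, ‖rhsF v r‖ ≤ C)
    (g : 𝓢(Ell 3, ℂ)) (l m : Fin 3) :
    IsTest (fun t => schwartzField fun l => cxS (v t l))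
      (fun t => schwartzField (rhsS fun i => cxS (v t i))) a b (schwartzField (rotS g l m)) := by
  obtain ⟨G, hG, hlim⟩ := exists_compactSupport_approx g
  simp only [norm_rhsF] at hX
  refine IsTest.of_tendsto hX (fun n => h.isTest_rotS_compact hv ha hb (hG n) l m) ?_
  have hs : ∀ (l m : Fin 3), Tendsto (fun n => schwartzField (Pi.single l (sd m (G n)))) atTop
      (nhds (schwartzField (Pi.single l (sd m g)))) := by
    intro l m
    refine tendsto_mkField _ _ fun j => ?_
    rcases eq_or_ne j l with rfl | hj
    · simpa using hlim m
    · simp [Pi.single_eq_of_ne hj]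
  exact (hs l m).sub (hs m l)

theorem IsNSSolution.isTest_rot_fourier (h : IsNSSolution T u p) (hv : IsSlices T u v)
    (ha : 0 ≤ a) (hb : b < T) (hX : ∀ r ∈ Set.Icc a b, ‖rhsF v r‖ ≤ C)
    (q : 𝓢(Ell 3, ℂ)) (l m : Fin 3) :
    IsTest (velF v) (rhsF v) a b
      (schwartzField (Pi.single l (rmulS (fun ξ => ξ m) q) -
        Pi.single m (rmulS (fun ξ => ξ l) q))) := by
  have h1 := (isTest_fourier_iff _).2 (h.isTest_rotS hv ha hb hX (𝓕⁻ q) l m)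
  have h2 := h1.smul (2 * Real.pi * Complex.I)⁻¹
  have hne : (2 * Real.pi * Complex.I) ≠ 0 := Complex.two_pi_I_ne_zero
  have hfs : ∀ m, 𝓕 (sd m (𝓕⁻ q)) = (2 * Real.pi * Complex.I) • rmulS (fun ξ => ξ m) q := by
    intro m
    ext ξ
    rw [fourier_sd, FourierTransform.fourier_fourierInv_eq, _root_.smul_apply,
      rmulS_apply (hasTemperateGrowth_coord m), smul_eq_mul]
    ring
  have hsing : ∀ (l : Fin 3) (f : 𝓢(Ell 3, ℂ)) (j : Fin 3),
      𝓕 ((Pi.single l f : Fin 3 → 𝓢(Ell 3, ℂ)) j) =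
        (Pi.single l (𝓕 f) : Fin 3 → 𝓢(Ell 3, ℂ)) j := by
    intro l f j
    rcases eq_or_ne j l with rfl | hj
    · simp
    · simp only [Pi.single_eq_of_ne hj]
      exact map_zero (FourierTransform.fourierCLM ℂ 𝓢(Ell 3, ℂ))
  have hrot : (fun j => 𝓕 (rotS (𝓕⁻ q) l m j)) = (2 * Real.pi * Complex.I) •
      (Pi.single l (rmulS (fun ξ => ξ m) q) -
        Pi.single m (rmulS (fun ξ => ξ l) q) : Fin 3 → 𝓢(Ell 3, ℂ)) := by
    funext j
    have : 𝓕 (rotS (𝓕⁻ q) l m j) = 𝓕 ((Pi.single l (sd m (𝓕⁻ q)) : Fin 3 → 𝓢(Ell 3, ℂ)) j) -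
        𝓕 ((Pi.single m (sd l (𝓕⁻ q)) : Fin 3 → 𝓢(Ell 3, ℂ)) j) :=
      map_sub (FourierTransform.fourierCLM ℂ 𝓢(Ell 3, ℂ)) _ _
    rw [this, hsing, hsing, hfs, hfs, smul_sub, ← Pi.single_smul, ← Pi.single_smul]
    rfl
  rw [hrot] at h2
  have e : ∀ (c : ℂ) (f : Fin 3 → 𝓢(Ell 3, ℂ)), schwartzField (c • f) = c • schwartzField f :=
    fun c f => rfl
  rwa [e, smul_smul, inv_mul_cancel₀ hne, one_smul] at h2

/-- Divergence-free fields multiplied by `|ξ|²ρ` are test fields. -/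
theorem IsNSSolution.isTest_normSq_mul (h : IsNSSolution T u p) (hv : IsSlices T u v)
    (ha : 0 ≤ a) (hb : b < T) (hX : ∀ r ∈ Set.Icc a b, ‖rhsF v r‖ ≤ C)
    {ρ : Ell 3 → ℝ} (hρ : ρ.HasTemperateGrowth) (k : Fin 3 → 𝓢(Ell 3, ℂ))
    (hk : ∀ ξ : Ell 3, ∑ l, (ξ l : ℂ) * k l ξ = 0) :
    IsTest (velF v) (rhsF v) a b
      (schwartzField fun l => rmulS (fun ξ => ‖ξ‖ ^ 2 * ρ ξ) (k l)) := by
  have h1 : IsTest (velF v) (rhsF v) a b (∑ l, ∑ m,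
      schwartzField (Pi.single l (rmulS (fun ξ => ξ m) (rmulS (fun ξ => ξ m * ρ ξ) (k l))) -
        Pi.single m (rmulS (fun ξ => ξ l) (rmulS (fun ξ => ξ m * ρ ξ) (k l))))) :=
    IsTest.sum _ fun l _ => IsTest.sum _ fun m _ => h.isTest_rot_fourier hv ha hb hX _ l m
  convert h1 using 1
  simp only [schwartzField, mkField_sum]
  refine mkField_congr _ _ ?_
  funext j ξ
  have hcoord := hasTemperateGrowth_coord
  have hs : ∀ (l : Fin 3) (f : 𝓢(Ell 3, ℂ)), ((Pi.single l f : Fin 3 → 𝓢(Ell 3, ℂ)) j) ξ =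
      if j = l then f ξ else 0 := by
    intro l f
    split_ifs with hj
    · subst hj; simp
    · simp [Pi.single_eq_of_ne hj]
  have hprod : ∀ m : Fin 3, (fun ξ : Ell 3 => ξ m * ρ ξ).HasTemperateGrowth :=
    fun m => (hcoord m).mul hρ
  have hn : (fun ξ : Ell 3 => ‖ξ‖ ^ 2 * ρ ξ).HasTemperateGrowth :=
    Function.HasTemperateGrowth.mul (by fun_prop) hρ
  simp only [Finset.sum_apply, Pi.sub_apply, _root_.sub_apply, hs, rmulS_apply hn,
    rmulS_apply (hcoord _), rmulS_apply (hprod _)]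
  have hξ := hk ξ
  rw [EuclideanSpace.real_norm_sq_eq]
  fin_cases j <;> simp [Fin.sum_univ_three] at hξ ⊢
  · linear_combination (ρ ξ : ℂ) * ξ 0 * hξ
  · linear_combination (ρ ξ : ℂ) * ξ 1 * hξ
  · linear_combination (ρ ξ : ℂ) * ξ 2 * hξ

theorem hasTemperateGrowth_normSq_add_rpow {δ : ℝ} (hδ : 0 < δ) (r : ℝ) :
    (fun ξ : Ell 3 => (‖ξ‖ ^ 2 + δ) ^ r).HasTemperateGrowth := by
  have h1 : (fun ξ : Ell 3 => (1 + ‖ξ‖ ^ 2) ^ r).HasTemperateGrowth :=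
    Function.hasTemperateGrowth_one_add_norm_sq_rpow (Ell 3) _
  have h2 : (fun ξ : Ell 3 => (Real.sqrt δ)⁻¹ • ξ).HasTemperateGrowth := by fun_prop
  have h3 := (h1.comp h2)
  have h4 : (fun _ : Ell 3 => δ ^ r).HasTemperateGrowth := by fun_prop
  have e : (fun ξ : Ell 3 => (‖ξ‖ ^ 2 + δ) ^ r) =
      fun ξ => δ ^ r * ((fun ξ : Ell 3 => (1 + ‖ξ‖ ^ 2) ^ r) ∘ fun ξ => (Real.sqrt δ)⁻¹ • ξ) ξ := by
    funext ξ
    simp only [Function.comp]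
    rw [← Real.mul_rpow hδ.le (by positivity), norm_smul, mul_pow, norm_inv, inv_pow,
      Real.norm_of_nonneg (Real.sqrt_nonneg _), Real.sq_sqrt hδ.le]
    congr 1
    field_simp
    ring
  rw [e]
  exact h4.mul h3

open scoped Topology in
/-- Divergence-free Schwartz fields with a weight `|ξ|^{2κ}` are test fields. -/
theorem IsNSSolution.isTest_weightField (h : IsNSSolution T u p) (hv : IsSlices T u v)
    (ha : 0 ≤ a) (hb : b < T) (hX : ∀ r ∈ Set.Icc a b, ‖rhsF v r‖ ≤ C)
    (k : Fin 3 → 𝓢(Ell 3, ℂ)) (hk : ∀ ξ : Ell 3, ∑ l, (ξ l : ℂ) * k l ξ = 0)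
    {κ : ℝ} (hκ : 0 ≤ κ) :
    IsTest (velF v) (rhsF v) a b (weightField hκ k) := by
  have hδ : ∀ n : ℕ, (0 : ℝ) < 1 / ((n : ℝ) + 1) := fun n => by positivity
  refine IsTest.of_tendsto hX (fun n => h.isTest_normSq_mul hv ha hb hX
    (hasTemperateGrowth_normSq_add_rpow (hδ n) (κ - 1)) k hk) ?_
  refine tendsto_mkField _ _ fun l => ?_
  have hn : ∀ n : ℕ, (fun ξ : Ell 3 => ‖ξ‖ ^ 2 *
      (‖ξ‖ ^ 2 + 1 / ((n : ℝ) + 1)) ^ (κ - 1)).HasTemperateGrowth := fun n =>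
    Function.HasTemperateGrowth.mul (by fun_prop) (hasTemperateGrowth_normSq_add_rpow (hδ n) _)
  have hg : (fun ξ : Ell 3 => (1 + ‖ξ‖ ^ 2) ^ κ).HasTemperateGrowth :=
    Function.hasTemperateGrowth_one_add_norm_sq_rpow (Ell 3) _
  set F := rmulS (fun ξ : Ell 3 => (1 + ‖ξ‖ ^ 2) ^ κ) (k l) with hF
  have hFa : ∀ ξ, ‖F ξ‖ = (1 + ‖ξ‖ ^ 2) ^ κ * ‖k l ξ‖ := by
    intro x
    rw [hF, rmulS_apply hg, norm_mul, Complex.norm_real, Real.norm_of_nonneg (by positivity)]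
  have hFi : Integrable fun ξ => ‖F ξ‖ ^ 2 := (F.memLp 2).norm.integrable_sq
  have e : ∀ (n : ℕ) (ξ : Ell 3), rmulS (fun ξ => ‖ξ‖ ^ 2 * (‖ξ‖ ^ 2 + 1 / ((n : ℝ) + 1)) ^ (κ - 1)) (k l) ξ -
      ((‖ξ‖ ^ (2 * κ) : ℝ) : ℂ) * k l ξ =
      ((‖ξ‖ ^ 2 * (‖ξ‖ ^ 2 + 1 / ((n : ℝ) + 1)) ^ (κ - 1) - ‖ξ‖ ^ (2 * κ) : ℝ) : ℂ) * k l ξ := by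
    intro n ξ
    rw [rmulS_apply (hn n)]
    push_cast
    ring
  have hb : ∀ (n : ℕ) (ξ : Ell 3),
      ‖ξ‖ ^ 2 * (‖ξ‖ ^ 2 + 1 / ((n : ℝ) + 1)) ^ (κ - 1) ≤ (1 + ‖ξ‖ ^ 2) ^ κ := by
    intro n ξ
    have hd := hδ n
    have hd1 : 1 / ((n : ℝ) + 1) ≤ 1 := by
      rw [div_le_one (by positivity)]; linarith [n.cast_nonneg (α := ℝ)]
    calc ‖ξ‖ ^ 2 * (‖ξ‖ ^ 2 + 1 / ((n : ℝ) + 1)) ^ (κ - 1)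
        ≤ (‖ξ‖ ^ 2 + 1 / ((n : ℝ) + 1)) * (‖ξ‖ ^ 2 + 1 / ((n : ℝ) + 1)) ^ (κ - 1) := by
          gcongr; linarith
      _ = (‖ξ‖ ^ 2 + 1 / ((n : ℝ) + 1)) ^ κ := by
          have : 0 < ‖ξ‖ ^ 2 + 1 / ((n : ℝ) + 1) := by positivity
          rw [Real.rpow_sub_one this.ne', mul_div_cancel₀ _ this.ne']
      _ ≤ (1 + ‖ξ‖ ^ 2) ^ κ := by gcongr ?_ ^ κ; linarith
  have h0 : (0 : ℝ) = ∫ _ : Ell 3, (0 : ℝ) := by simp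
  rw [h0]
  refine tendsto_integral_of_dominated_convergence (fun ξ => ‖F ξ‖ ^ 2) (fun n => ?_) hFi
    (fun n => Eventually.of_forall fun ξ => ?_) ?_
  · exact ((((rmulS _ (k l)).memLp 2).sub (memLp_weight hκ (k l))).aestronglyMeasurable.norm.pow 2)
  · rw [e, norm_mul, Complex.norm_real, Real.norm_eq_abs, abs_of_nonneg (by positivity), hFa]
    gcongr
    rw [Real.norm_eq_abs, abs_le]
    have h1 := hb n ξ
    have h2 := rpow_le_one_add_sq hκ ξ
    have h3 : 0 ≤ ‖ξ‖ ^ (2 * κ) := by positivity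
    have h4 : 0 ≤ ‖ξ‖ ^ 2 * (‖ξ‖ ^ 2 + 1 / ((n : ℝ) + 1)) ^ (κ - 1) := by positivity
    constructor <;> linarith
  · have hne : ∀ᵐ ξ : Ell 3, ξ ≠ 0 := by
      simp [ae_iff]
    filter_upwards [hne] with ξ hξ
    simp only [e]
    have hpos : 0 < ‖ξ‖ ^ 2 := by have := norm_pos_iff.2 hξ; positivity
    have hlim : Tendsto (fun n : ℕ => ‖ξ‖ ^ 2 * (‖ξ‖ ^ 2 + 1 / ((n : ℝ) + 1)) ^ (κ - 1) -
        ‖ξ‖ ^ (2 * κ)) atTop (𝓝 0) := by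
      have h1 : Tendsto (fun n : ℕ => ‖ξ‖ ^ 2 + 1 / ((n : ℝ) + 1)) atTop (𝓝 (‖ξ‖ ^ 2 + 0)) :=
        tendsto_const_nhds.add tendsto_one_div_add_atTop_nhds_zero_nat
      rw [add_zero] at h1
      have h2 := ((h1.rpow_const (p := κ - 1) (Or.inl hpos.ne')).const_mul (‖ξ‖ ^ 2)).sub_const
        (‖ξ‖ ^ (2 * κ))
      convert h2 using 2
      rw [Real.rpow_mul (norm_nonneg _), Real.rpow_two, Real.rpow_sub_one hpos.ne',
        mul_div_cancel₀ _ hpos.ne', sub_self]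
    have h3 := ((Complex.continuous_ofReal.tendsto 0).comp hlim).mul_const (k l ξ)
    simpa using (h3.norm.pow 2)

end Solution

theorem integrable_rpow_mul_normSq {κ : ℝ} (hκ : 0 ≤ κ) (f : 𝓢(Ell 3, ℂ)) :
    Integrable fun ξ : Ell 3 => ‖ξ‖ ^ κ * ‖f ξ‖ ^ 2 := by
  refine (memLp_weight (κ := κ / 4) (by positivity) f).norm.integrable_sq.congr
    (Eventually.of_forall fun ξ => ?_)
  simp only [norm_mul, Complex.norm_real]
  rw [Real.norm_of_nonneg (by positivity), mul_pow, ← Real.rpow_mul_natCast (norm_nonneg _)]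
  congr 2
  push_cast
  ring

/-- The squared homogeneous Sobolev norm of order `κ / 2`. -/
def sob (κ : ℝ) (V : Fin 3 → 𝓢(Ell 3, ℂ)) : ℝ := ∑ l, ∫ ξ, ‖ξ‖ ^ κ * ‖𝓕 (V l) ξ‖ ^ 2

theorem sob_nonneg (κ : ℝ) (V : Fin 3 → 𝓢(Ell 3, ℂ)) : 0 ≤ sob κ V :=
  Finset.sum_nonneg fun l _ => integral_nonneg fun ξ => by positivity

theorem integral_le_sob (κ : ℝ) (V : Fin 3 → 𝓢(Ell 3, ℂ)) (l : Fin 3) :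
    ∫ ξ, ‖ξ‖ ^ κ * ‖𝓕 (V l) ξ‖ ^ 2 ≤ sob κ V :=
  Finset.single_le_sum (f := fun l => ∫ ξ, ‖ξ‖ ^ κ * ‖𝓕 (V l) ξ‖ ^ 2)
    (fun l _ => integral_nonneg fun ξ => by positivity) (Finset.mem_univ l)

theorem Hnorm_sq (s : ℝ) (v : Fin 3 → 𝓢(Ell 3, ℝ)) :
    Hnorm s (fun l x => v l x) ^ 2 = sob (2 * s) fun l => cxS (v l) := by
  have h : ∑ l, HsqC s (cf fun x => v l x) = sob (2 * s) fun l => cxS (v l) := rfl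
  rw [Hnorm, h, Real.sq_sqrt (sob_nonneg _ _)]

theorem sob_le_of_le {κ σ : ℝ} (hκ : 0 ≤ κ) (hκσ : κ ≤ σ) (V : Fin 3 → 𝓢(Ell 3, ℂ)) :
    sob κ V ≤ sob 0 V + sob σ V := by
  rw [sob, sob, sob, ← Finset.sum_add_distrib]
  refine Finset.sum_le_sum fun l _ => ?_
  have i0 := integrable_rpow_mul_normSq le_rfl (𝓕 (V l))
  have iσ := integrable_rpow_mul_normSq (hκ.trans hκσ) (𝓕 (V l))
  rw [← integral_add i0 iσ]
  refine integral_mono (integrable_rpow_mul_normSq hκ _) (i0.add iσ) fun ξ => ?_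
  simp only [Real.rpow_zero, ← add_mul]
  gcongr
  rcases le_total ‖ξ‖ 1 with h | h
  · have := Real.rpow_le_one (norm_nonneg ξ) h hκ
    have := Real.rpow_nonneg (norm_nonneg ξ) σ
    linarith
  · have := Real.rpow_le_rpow_of_exponent_le h hκσ
    linarith

theorem norm_le_integral_norm_fourier (f : 𝓢(Ell 3, ℂ)) (x : Ell 3) :
    ‖f x‖ ≤ ∫ ξ, ‖𝓕 f ξ‖ := by
  have h : f x = 𝓕⁻ (𝓕 f) x := by rw [FourierTransform.fourierInv_fourier_eq]
  rw [h, SchwartzMap.fourierInv_coe, Real.fourierInv_eq]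
  refine (norm_integral_le_integral_norm _).trans (le_of_eq ?_)
  simp [Circle.norm_smul]

theorem exists_norm_le_of_sob_le (S : ℝ) : ∃ M : ℝ, 0 ≤ M ∧ ∀ V : Fin 3 → 𝓢(Ell 3, ℂ),
    sob 0 V + sob 5 V ≤ S → ∀ l x, ‖V l x‖ ≤ M := by
  have hI : Integrable fun ξ : Ell 3 => (1 + ‖ξ‖) ^ (-4 : ℝ) :=
    integrable_one_add_norm (by simp; norm_num)
  refine ⟨|(∫ ξ : Ell 3, (1 + ‖ξ‖) ^ (-4 : ℝ)) + 16 * S|, abs_nonneg _, fun V hV l x => ?_⟩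
  refine (norm_le_integral_norm_fourier _ _).trans (le_trans ?_ (le_abs_self _))
  have i0 := integrable_rpow_mul_normSq le_rfl (𝓕 (V l))
  have i5 := integrable_rpow_mul_normSq (κ := 5) (by norm_num) (𝓕 (V l))
  have hle : ∫ ξ, ‖𝓕 (V l) ξ‖ ≤ ∫ ξ, ((1 + ‖ξ‖) ^ (-4 : ℝ) +
      16 * (‖ξ‖ ^ (0 : ℝ) * ‖𝓕 (V l) ξ‖ ^ 2 + ‖ξ‖ ^ (5 : ℝ) * ‖𝓕 (V l) ξ‖ ^ 2)) := by
    refine integral_mono (𝓕 (V l)).integrable.norm (hI.add ((i0.add i5).const_mul 16)) fun ξ => ?_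
    simp only [Real.rpow_zero]
    have e4 : (1 + ‖ξ‖) ^ (-4 : ℝ) = ((1 + ‖ξ‖) ^ 4)⁻¹ := by
      rw [Real.rpow_neg (by positivity)]; norm_cast
    have e5 : ‖ξ‖ ^ (5 : ℝ) = ‖ξ‖ ^ 5 := by norm_cast
    rw [e4, e5]
    set r := ‖ξ‖
    have hr : 0 ≤ r := norm_nonneg _
    set b := ‖𝓕 (V l) ξ‖
    have hb : 0 ≤ b := norm_nonneg _
    have hw : (1 + r) ^ 4 ≤ 16 * (1 + r ^ 5) := by
      rcases le_total r 1 with h | h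
      · have : (1 + r) ^ 4 ≤ (1 + 1) ^ 4 := by gcongr
        have : 0 ≤ r ^ 5 := by positivity
        linarith
      · have : (1 + r) ^ 4 ≤ (r + r) ^ 4 := by gcongr
        have : r ^ 4 ≤ r ^ 5 := pow_le_pow_right₀ h (by norm_num)
        nlinarith
    have hp : 0 < (1 + r) ^ 4 := by positivity
    set w := (1 + r) ^ 4
    have h1 : b ≤ w⁻¹ + w * b ^ 2 := by
      have : 0 ≤ w⁻¹ * ((w * b - 1) ^ 2 + w * b) := by positivity
      have e : w⁻¹ * ((w * b - 1) ^ 2 + w * b) = w * b ^ 2 - b + w⁻¹ := by field_simp; ring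
      linarith
    nlinarith [mul_le_mul_of_nonneg_right hw (sq_nonneg b)]
  refine hle.trans ?_
  have i05 : Integrable fun ξ : Ell 3 =>
    ‖ξ‖ ^ (0 : ℝ) * ‖𝓕 (V l) ξ‖ ^ 2 + ‖ξ‖ ^ (5 : ℝ) * ‖𝓕 (V l) ξ‖ ^ 2 := i0.add i5
  rw [integral_add hI (i05.const_mul 16), integral_const_mul, integral_add i0 i5]
  have h0 := integral_le_sob 0 V l
  have h5 := integral_le_sob 5 V l
  linarith

theorem integral_norm_sq_sd_le (V : Fin 3 → 𝓢(Ell 3, ℂ)) (i l : Fin 3) :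
    ∫ x, ‖sd i (V l) x‖ ^ 2 ≤ 4 * Real.pi ^ 2 * sob 2 V := by
  rw [← SchwartzMap.integral_norm_sq_fourier]
  refine le_trans ?_ (mul_le_mul_of_nonneg_left (integral_le_sob 2 V l) (by positivity))
  rw [← integral_const_mul]
  refine integral_mono ((𝓕 (sd i (V l))).memLp 2).norm.integrable_sq
    ((integrable_rpow_mul_normSq (by norm_num) _).const_mul _) fun ξ => ?_
  simp only [fourier_sd, norm_mul, Complex.norm_real, Complex.norm_I, Complex.norm_ofNat,
    Real.rpow_ofNat, mul_one]
  have h : ‖ξ i‖ ^ 2 ≤ ‖ξ‖ ^ 2 := by gcongr; exact PiLp.norm_apply_le ξ i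
  rw [mul_pow, mul_pow, mul_pow, Real.norm_of_nonneg Real.pi_pos.le]
  calc _ = 4 * Real.pi ^ 2 * (‖ξ i‖ ^ 2 * ‖𝓕 (V l) ξ‖ ^ 2) := by ring
    _ ≤ _ := by gcongr

theorem integral_norm_sq_laplacian_le (V : Fin 3 → 𝓢(Ell 3, ℂ)) (l : Fin 3) :
    ∫ x, ‖(Δ (V l)) x‖ ^ 2 ≤ 16 * Real.pi ^ 4 * sob 4 V := by
  rw [← SchwartzMap.integral_norm_sq_fourier]
  refine le_trans (le_of_eq ?_) (mul_le_mul_of_nonneg_left (integral_le_sob 4 V l) (by positivity))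
  rw [← integral_const_mul]
  congr 1
  funext ξ
  rw [fourier_laplacian, norm_mul, norm_neg, Complex.norm_real, Real.norm_of_nonneg (by positivity),
    Real.rpow_ofNat]
  ring

theorem exists_norm_rhsS_le (S : ℝ) : ∃ C : ℝ, ∀ V : Fin 3 → 𝓢(Ell 3, ℂ),
    sob 0 V + sob 5 V ≤ S → ‖schwartzField (rhsS V)‖ ≤ C := by
  obtain ⟨M, hM0, hM⟩ := exists_norm_le_of_sob_le S
  refine ⟨Real.sqrt (∑ _l : Fin 3, 4 * (16 * Real.pi ^ 4 * S +
    ∑ _i : Fin 3, M ^ 2 * (4 * Real.pi ^ 2 * S))), fun V hV => Real.le_sqrt_of_sq_le ?_⟩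
  rw [schwartzField, norm_mkField_sq]
  refine Finset.sum_le_sum fun l _ => ?_
  have hΔ : Integrable fun x => ‖(Δ (V l)) x‖ ^ 2 := ((Δ (V l)).memLp 2).norm.integrable_sq
  have hd : ∀ i, Integrable fun x => ‖sd i (V l) x‖ ^ 2 :=
    fun i => ((sd i (V l)).memLp 2).norm.integrable_sq
  have hds : Integrable fun x => ∑ i, M ^ 2 * ‖sd i (V l) x‖ ^ 2 :=
    integrable_finsetSum _ fun i _ => (hd i).const_mul _
  calc ∫ x, ‖rhsS V l x‖ ^ 2
      ≤ ∫ x, 4 * (‖(Δ (V l)) x‖ ^ 2 + ∑ i, M ^ 2 * ‖sd i (V l) x‖ ^ 2) := by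
        refine integral_mono ((rhsS V l).memLp 2).norm.integrable_sq
          ((hΔ.add hds).const_mul 4) fun x => ?_
        have h1 : ‖rhsS V l x‖ ≤ ‖(Δ (V l)) x‖ + ∑ i, M * ‖sd i (V l) x‖ := by
          rw [rhsS, _root_.sub_apply, advS_apply]
          refine (norm_sub_le _ _).trans ?_
          gcongr
          refine (norm_sum_le _ _).trans (Finset.sum_le_sum fun i _ => ?_)
          rw [norm_mul]
          gcongr
          exact hM V hV i x
        calc ‖rhsS V l x‖ ^ 2 ≤ (‖(Δ (V l)) x‖ + ∑ i, M * ‖sd i (V l) x‖) ^ 2 := by gcongr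
          _ ≤ _ := by
            simp only [Fin.sum_univ_three]
            generalize ‖(Δ (V l)) x‖ = a
            simp only [← mul_pow]
            generalize M * ‖sd 0 (V l) x‖ = b
            generalize M * ‖sd 1 (V l) x‖ = c
            generalize M * ‖sd 2 (V l) x‖ = d
            nlinarith [sq_nonneg (a - b), sq_nonneg (a - c), sq_nonneg (a - d), sq_nonneg (b - c),
              sq_nonneg (b - d), sq_nonneg (c - d)]
    _ = 4 * ((∫ x, ‖(Δ (V l)) x‖ ^ 2) + ∑ i, M ^ 2 * ∫ x, ‖sd i (V l) x‖ ^ 2) := by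
        rw [integral_const_mul, integral_add hΔ hds,
          integral_finsetSum _ fun i _ => (hd i).const_mul _]
        simp only [integral_const_mul]
    _ ≤ _ := by
        have h4 : sob 4 V ≤ S := (sob_le_of_le (by norm_num) (by norm_num) V).trans hV
        have h2 : sob 2 V ≤ S := (sob_le_of_le (by norm_num) (by norm_num) V).trans hV
        gcongr with i
        · exact (integral_norm_sq_laplacian_le V l).trans (by gcongr)
        · exact (integral_norm_sq_sd_le V i l).trans (by gcongr)

/-- A divergence-free field is orthogonal to the frequency variable. -/
theorem sum_coord_mul_fourier_eq_zero {V : Fin 3 → 𝓢(Ell 3, ℂ)} (hV : ∀ x, ∑ i, sd i (V i) x = 0)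
    (ξ : Ell 3) : ∑ l, (ξ l : ℂ) * 𝓕 (V l) ξ = 0 := by
  have h0 : ∑ i, sd i (V i) = 0 := by ext x; simpa using hV x
  have h1 : ∑ i, 𝓕 (sd i (V i)) = 0 := by
    have := congrArg (FourierTransform.fourierCLM ℂ 𝓢(Ell 3, ℂ)) h0
    rw [map_sum, map_zero] at this
    exact this
  have h2 := congrArg (fun f : 𝓢(Ell 3, ℂ) => f ξ) h1
  simp only [_root_.sum_apply, fourier_sd, _root_.zero_apply] at h2
  have h3 : ∑ i, 2 * Real.pi * Complex.I * (ξ i) * 𝓕 (V i) ξ =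
      (2 * Real.pi * Complex.I) * ∑ i, (ξ i : ℂ) * 𝓕 (V i) ξ := by
    rw [Finset.mul_sum]; exact Finset.sum_congr rfl fun i _ => by ring
  rw [h3] at h2
  exact (mul_eq_zero.1 h2).resolve_left Complex.two_pi_I_ne_zero

/-- The advection term does no work on a real divergence-free field. -/
theorem inner_advS_eq_zero (v : Fin 3 → 𝓢(Ell 3, ℝ))
    (hv : ∀ x, ∑ i, sd i (cxS (v i)) x = 0) :
    ⟪schwartzField fun l => cxS (v l), schwartzField (advS fun l => cxS (v l))⟫_ℂ = 0 := by
  rw [schwartzField, schwartzField, inner_mkField]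
  refine Finset.sum_eq_zero fun l _ => ?_
  set V : Fin 3 → 𝓢(Ell 3, ℂ) := fun l => cxS (v l) with hV
  have hterm : ∀ x, conj (V l x) * advS V l x = ∑ i, smulS (smulS (V i) (V l)) (sd i (V l)) x := by
    intro x
    rw [advS_apply, Finset.mul_sum]
    refine Finset.sum_congr rfl fun i _ => ?_
    simp only [smulS_apply, hV, cxS_apply, Complex.conj_ofReal]
    ring
  refine (integral_congr_ae (Eventually.of_forall hterm)).trans ?_
  rw [integral_finsetSum _ fun i _ => (smulS (smulS (V i) (V l)) (sd i (V l))).integrable]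
  have ibp : ∀ i, ∫ x, smulS (smulS (V i) (V l)) (sd i (V l)) x =
      -(∫ x, smulS (smulS (V l) (V l)) (sd i (V i)) x)
        - ∫ x, smulS (smulS (V i) (V l)) (sd i (V l)) x := by
    intro i
    have h := SchwartzMap.integral_mul_lineDerivOp_right_eq_neg_left (μ := volume)
      (smulS (V i) (V l)) (V l) (eVec 3 i)
    have h' : ∫ x, smulS (smulS (V i) (V l)) (sd i (V l)) x =
        -∫ x, sd i (smulS (V i) (V l)) x * V l x := h
    refine h'.trans ?_
    rw [← neg_add', ← integral_add (smulS (smulS (V l) (V l)) (sd i (V i))).integrable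
        (smulS (smulS (V i) (V l)) (sd i (V l))).integrable]
    congr 2
    funext x
    have e : sd i (smulS (V i) (V l)) x = V i x * sd i (V l) x + sd i (V i) x * V l x := by
      rw [sd_apply, sd_apply, sd_apply]
      have : (⇑(smulS (V i) (V l)) : Ell 3 → ℂ) = fun y => V i y * V l y := rfl
      rw [this, fderiv_fun_mul (V i).differentiableAt (V l).differentiableAt]
      simp [mul_comm]
    rw [e]
    simp only [smulS_apply]
    ring
  have hdiv : ∑ i, ∫ x, smulS (smulS (V l) (V l)) (sd i (V i)) x = 0 := by
    rw [← integral_finsetSum _ fun i _ => (smulS (smulS (V l) (V l)) (sd i (V i))).integrable]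
    have hv' : ∀ x, ∑ i, sd i (V i) x = 0 := hv
    simp only [smulS_apply, ← Finset.mul_sum, hv', mul_zero, integral_zero]
  have hsum := Finset.sum_congr (rfl : (Finset.univ : Finset (Fin 3)) = Finset.univ)
    fun i _ => ibp i
  rw [Finset.sum_sub_distrib, Finset.sum_neg_distrib, hdiv] at hsum
  linear_combination hsum / 2

theorem inner_weightField_schwartzField {κ : ℝ} (hκ : 0 ≤ κ) (k f : Fin 3 → 𝓢(Ell 3, ℂ)) :
    ⟪weightField hκ k, schwartzField f⟫_ℂ =
      ∑ l, ∫ ξ, ((‖ξ‖ ^ (2 * κ) : ℝ) : ℂ) * (conj (k l ξ) * f l ξ) := by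
  rw [weightField, schwartzField, inner_mkField]
  simp [mul_assoc]

theorem weightField_zero (k : Fin 3 → 𝓢(Ell 3, ℂ)) : weightField le_rfl k = schwartzField k :=
  mkField_congr _ _ (by funext l ξ; simp)

theorem norm_schwartzField_fourier_sq (V : Fin 3 → 𝓢(Ell 3, ℂ)) :
    ‖schwartzField fun l => 𝓕 (V l)‖ ^ 2 = sob 0 V := by
  rw [schwartzField, norm_mkField_sq]
  simp [sob]

theorem inner_weightField_rhsS {κ : ℝ} (hκ : 0 ≤ κ) (V : Fin 3 → 𝓢(Ell 3, ℂ)) :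
    ⟪weightField hκ fun l => 𝓕 (V l), schwartzField fun l => 𝓕 (rhsS V l)⟫_ℂ =
      -((4 * Real.pi ^ 2 * sob (2 * κ + 2) V : ℝ) : ℂ) -
        ⟪weightField hκ fun l => 𝓕 (V l), schwartzField fun l => 𝓕 (advS V l)⟫_ℂ := by
  have e : (schwartzField fun l => 𝓕 (rhsS V l)) =
      (schwartzField fun l => 𝓕 (Δ (V l))) - schwartzField fun l => 𝓕 (advS V l) := by
    have : ∀ l, 𝓕 (rhsS V l) = 𝓕 (Δ (V l)) - 𝓕 (advS V l) := fun l =>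
      map_sub (FourierTransform.fourierCLM ℂ 𝓢(Ell 3, ℂ)) _ _
    simp only [this]
    rfl
  rw [e, inner_sub_right]
  congr 1
  rw [inner_weightField_schwartzField, sob, Finset.mul_sum, Complex.ofReal_sum,
    ← Finset.sum_neg_distrib]
  refine Finset.sum_congr rfl fun l _ => ?_
  rw [← integral_const_mul, ← integral_complex_ofReal, ← integral_neg]
  congr 1
  funext ξ
  rw [fourier_laplacian]
  rw [Real.rpow_add_of_nonneg (norm_nonneg _) (by positivity) (by norm_num), Real.rpow_ofNat]
  have := Complex.conj_mul' (𝓕 (V l) ξ)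
  push_cast
  linear_combination (-(‖ξ‖ ^ (2 * κ) : ℝ) * (4 * Real.pi ^ 2 * ‖ξ‖ ^ 2) : ℂ) * this

open Set Topology in
theorem exists_bound_of_local_bound {y : ℝ → ℝ} {K S : Set ℝ} (hK : IsCompact K)
    (hKS : K ⊆ S)
    (h : ∀ t ∈ K, ∃ Y, ∀ᶠ s in 𝓝[S] t, y s ≤ Y) : ∃ Y, ∀ t ∈ K, y t ≤ Y := by
  refine hK.induction_on (p := fun s => ∃ Y, ∀ t ∈ s, y t ≤ Y) ⟨0, by simp⟩ ?_ ?_ ?_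
  · rintro s t hst ⟨Y, hY⟩
    exact ⟨Y, fun r hr => hY r (hst hr)⟩
  · rintro s t ⟨Y, hY⟩ ⟨Z, hZ⟩
    refine ⟨max Y Z, ?_⟩
    rintro r (hr | hr)
    · exact (hY r hr).trans (le_max_left _ _)
    · exact (hZ r hr).trans (le_max_right _ _)
  · intro t ht
    obtain ⟨Y, hY⟩ := h t ht
    exact ⟨{s | y s ≤ Y}, nhdsWithin_mono t hKS hY, Y, fun r hr => hr⟩

open Set Topology in
/-- A function with closed sublevel sets that does not increase along intervals with locally
bounded interior is bounded on compact intervals. -/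
theorem exists_bound_of_isClosed_sublevel {y : ℝ → ℝ} {a b : ℝ}
    (hcl : ∀ c, IsClosed {t | t ∈ Icc a b ∧ y t ≤ c})
    (hdec : ∀ s ∈ Icc a b, ∀ t ∈ Icc a b, s ≤ t →
      (∀ r ∈ Ioc s t, ∃ Y, ∀ q ∈ Icc r t, y q ≤ Y) → y t ≤ y s) :
    ∃ Y, ∀ t ∈ Icc a b, y t ≤ Y := by
  set good : ℝ → Prop := fun t => ∃ Y, ∀ᶠ s in 𝓝[Icc a b] t, y s ≤ Y with hgood
  set B : Set ℝ := {t | t ∈ Icc a b ∧ ¬ good t} with hB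
  rcases B.eq_empty_or_nonempty with hBe | hBne
  · refine exists_bound_of_local_bound isCompact_Icc subset_rfl fun t ht => ?_
    by_contra hc
    exact (hBe ▸ (⟨ht, hc⟩ : t ∈ B) : t ∈ (∅ : Set ℝ))
  exfalso
  have hBc : IsClosed B := by
    rw [← isOpen_compl_iff, isOpen_iff_mem_nhds]
    intro t ht
    by_cases hti : t ∈ Icc a b
    · have hg : good t := by
        by_contra hc; exact ht ⟨hti, hc⟩
      obtain ⟨Y, hY⟩ := hg
      obtain ⟨O, hO, htO, hOY⟩ := mem_nhdsWithin.1 hY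
      filter_upwards [hO.mem_nhds htO] with s hs hsB
      exact hsB.2 ⟨Y, mem_nhdsWithin.2 ⟨O, hO, hs, hOY⟩⟩
    · filter_upwards [isClosed_Icc.isOpen_compl.mem_nhds hti] with s hs hsB
      exact hs hsB.1
  have : CompleteSpace B := hBc.completeSpace_coe
  have : Nonempty B := hBne.to_subtype
  have hF : ∀ n : ℕ, IsClosed {t : B | y t ≤ n} := by
    intro n
    convert (hcl n).preimage (continuous_subtype_val (p := (· ∈ B))) using 1
    ext t
    exact ⟨fun h => ⟨t.2.1, h⟩, fun h => h.2⟩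
  obtain ⟨n, t0, ht0⟩ := nonempty_interior_of_iUnion_of_closed hF
    (eq_univ_of_forall fun t => mem_iUnion.2 (exists_nat_ge (y t)))
  rw [mem_interior_iff_mem_nhds, Metric.mem_nhds_iff] at ht0
  obtain ⟨δ, hδ, hball⟩ := ht0
  have hBn : ∀ t ∈ B, |t - t0| < δ → y t ≤ n := fun t ht hd =>
    hball (show (⟨t, ht⟩ : B) ∈ Metric.ball t0 δ from hd)
  set c := max a ((t0 : ℝ) - δ / 2) with hc
  have hca : a ≤ c := le_max_left _ _
  have hcδ : (t0 : ℝ) - δ / 2 ≤ c := le_max_right _ _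
  have hbound : ∀ t ∈ Icc a b, c ≤ t → t < t0 + δ → y t ≤ max (n : ℝ) (y c) := by
    intro t ht hct htδ
    set K : Set ℝ := (B ∪ {c}) ∩ Icc c t with hK
    have hKc : IsCompact K := isCompact_Icc.inter_left (hBc.union isClosed_singleton)
    have hKne : K.Nonempty := ⟨c, Or.inr rfl, le_rfl, hct⟩
    set s := sSup K with hs
    have hsK : s ∈ K := hKc.sSup_mem hKne
    have hsi : s ∈ Icc a b := ⟨hca.trans hsK.2.1, hsK.2.2.trans ht.2⟩
    have hts : y t ≤ y s := by
      refine hdec s hsi t ht hsK.2.2 fun r hr => ?_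
      refine exists_bound_of_local_bound (S := Icc a b) isCompact_Icc
        (Icc_subset_Icc (hsi.1.trans hr.1.le) ht.2) fun q hq => ?_
      by_contra hcon
      have hqB : q ∈ B := ⟨⟨(hsi.1.trans hr.1.le).trans hq.1, hq.2.trans ht.2⟩, hcon⟩
      have hqK : q ∈ K := ⟨Or.inl hqB, hsK.2.1.trans (hr.1.le.trans hq.1), hq.2⟩
      exact absurd (le_csSup hKc.bddAbove hqK) (not_le.2 (hr.1.trans_le hq.1))
    refine hts.trans ?_
    rcases hsK.1 with hsB | hsc
    · refine (hBn s hsB ?_).trans (le_max_left _ _)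
      have h1 := hsK.2.1
      have h2 := hsK.2.2
      rw [abs_lt]; constructor <;> linarith
    · rw [mem_singleton_iff.1 hsc]; exact le_max_right _ _
  refine t0.2.2 ⟨max (n : ℝ) (y c), ?_⟩
  have hn : Ioo ((t0 : ℝ) - δ / 2) (t0 + δ) ∈ 𝓝[Icc a b] (t0 : ℝ) :=
    mem_nhdsWithin_of_mem_nhds (Ioo_mem_nhds (by linarith) (by linarith))
  filter_upwards [hn, self_mem_nhdsWithin] with s hs hsi
  exact hbound s hsi (max_le hsi.1 hs.1.le) hs.2

/-- The complexified velocity at a given time. -/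
def vel (v : ℝ → Fin 3 → 𝓢(Ell 3, ℝ)) (t : ℝ) (l : Fin 3) : 𝓢(Ell 3, ℂ) := cxS (v t l)

theorem norm_velF_sq (v : ℝ → Fin 3 → 𝓢(Ell 3, ℝ)) (t : ℝ) : ‖velF v t‖ ^ 2 = sob 0 (vel v t) :=
  norm_schwartzField_fourier_sq (vel v t)

theorem sob_zero_eq (V : Fin 3 → 𝓢(Ell 3, ℂ)) : sob 0 V = ∑ l, ∫ x, ‖V l x‖ ^ 2 := by
  simp [sob, SchwartzMap.integral_norm_sq_fourier]

section Solution

variable {T : ℝ} {u : ℝ → Ell 3 → Fin 3 → ℝ} {p : ℝ → Ell 3 → ℝ}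
  {v : ℝ → Fin 3 → 𝓢(Ell 3, ℝ)} {a b C D Y : ℝ}

theorem IsNSSolution.div_slices (h : IsNSSolution T u p) (hv : IsSlices T u v) {t : ℝ}
    (ht : t ∈ Set.Ico 0 T) (x : Ell 3) :
    ∑ i, fderiv ℝ (fun y => v t i y) x (eVec 3 i) = 0 := by
  have h1 := h.2.2.2.1 t ht x
  have e : ∀ i, (fun y => u t y i) = fun y => v t i y := fun i => funext fun y => hv t ht i y
  simpa only [e] using h1

theorem IsNSSolution.div_vel (h : IsNSSolution T u p) (hv : IsSlices T u v) {t : ℝ}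
    (ht : t ∈ Set.Ico 0 T) (x : Ell 3) : ∑ i, sd i (vel v t i) x = 0 := by
  have h1 := h.div_slices hv ht x
  simp only [vel, sd_cxS]
  exact_mod_cast h1

theorem IsNSSolution.isTest_weightField_vel (h : IsNSSolution T u p) (hv : IsSlices T u v)
    (ha : 0 ≤ a) (hb : b < T) (hX : ∀ r ∈ Set.Icc a b, ‖rhsF v r‖ ≤ C) {κ : ℝ} (hκ : 0 ≤ κ)
    {t : ℝ} (ht : t ∈ Set.Icc a b) :
    IsTest (velF v) (rhsF v) a b (weightField hκ fun l => 𝓕 (vel v t l)) :=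
  h.isTest_weightField hv ha hb hX _
    (sum_coord_mul_fourier_eq_zero (h.div_vel hv ⟨ha.trans ht.1, ht.2.trans_lt hb⟩)) hκ

theorem IsNSSolution.isTest_velF (h : IsNSSolution T u p) (hv : IsSlices T u v)
    (ha : 0 ≤ a) (hb : b < T) (hX : ∀ r ∈ Set.Icc a b, ‖rhsF v r‖ ≤ C)
    {t : ℝ} (ht : t ∈ Set.Icc a b) : IsTest (velF v) (rhsF v) a b (velF v t) := by
  have h1 := h.isTest_weightField_vel hv ha hb hX le_rfl ht
  rwa [weightField_zero] at h1

theorem exists_norm_rhsF_le (v : ℝ → Fin 3 → 𝓢(Ell 3, ℝ))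
    (hD : ∀ t ∈ Set.Icc a b, sob 5 (vel v t) ≤ D) (hY : ∀ t ∈ Set.Icc a b, sob 0 (vel v t) ≤ Y) :
    ∃ C, ∀ r ∈ Set.Icc a b, ‖rhsF v r‖ ≤ C := by
  obtain ⟨C, hC⟩ := exists_norm_rhsS_le (Y + D)
  refine ⟨C, fun r hr => ?_⟩
  rw [norm_rhsF]
  exact hC _ (add_le_add (hY r hr) (hD r hr))

theorem IsNSSolution.continuousOn_velF (h : IsNSSolution T u p) (hv : IsSlices T u v)
    (ha : 0 ≤ a) (hb : b < T) (hX : ∀ r ∈ Set.Icc a b, ‖rhsF v r‖ ≤ C) :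
    ContinuousOn (velF v) (Set.Icc a b) := by
  have hl : LipschitzOnWith (Real.toNNReal C) (velF v) (Set.Icc a b) := by
    refine LipschitzOnWith.of_dist_le_mul fun s hs t ht => ?_
    have hC : 0 ≤ C := (norm_nonneg _).trans (hX s hs)
    rw [Real.coe_toNNReal _ hC]
    rcases le_total s t with hst | hst
    · rw [dist_comm, dist_eq_norm, dist_comm, Real.dist_eq, abs_of_nonneg (by linarith)]
      exact norm_sub_le_of_isTest hX (fun t ht => h.isTest_velF hv ha hb hX ht) hs ht hst
    · rw [dist_eq_norm, Real.dist_eq, abs_of_nonneg (by linarith)]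
      exact norm_sub_le_of_isTest hX (fun t ht => h.isTest_velF hv ha hb hX ht) ht hs hst
  exact hl.continuousOn

theorem IsNSSolution.re_inner_velF_rhsF (h : IsNSSolution T u p) (hv : IsSlices T u v) {t : ℝ}
    (ht : t ∈ Set.Ico 0 T) :
    (⟪velF v t, rhsF v t⟫_ℂ).re = -(4 * Real.pi ^ 2 * sob 2 (vel v t)) := by
  have h1 := inner_weightField_rhsS (κ := 0) le_rfl (vel v t)
  have h0 : ⟪schwartzField (vel v t), schwartzField (advS (vel v t))⟫_ℂ = 0 :=
    inner_advS_eq_zero (v t) (h.div_vel hv ht)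
  rw [weightField_zero, inner_schwartzField_fourier (vel v t) (advS (vel v t)),
    h0, mul_zero, zero_add, sub_zero] at h1
  have h2 : ⟪velF v t, rhsF v t⟫_ℂ = -((4 * Real.pi ^ 2 * sob 2 (vel v t) : ℝ) : ℂ) := h1
  rw [h2, Complex.neg_re, Complex.ofReal_re]

open scoped Topology in
theorem IsNSSolution.energy_left_deriv (h : IsNSSolution T u p) (hv : IsSlices T u v)
    (ha : 0 ≤ a) (hb : b < T) (hX : ∀ r ∈ Set.Icc a b, ‖rhsF v r‖ ≤ C)
    {t : ℝ} (ht : t ∈ Set.Ioc a b) {η : ℝ} (hη : 0 < η) :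
    ∀ᶠ s in 𝓝[<] t, |sob 0 (vel v t) - sob 0 (vel v s) +
      8 * Real.pi ^ 2 * sob 2 (vel v t) * (t - s)| ≤ η * (t - s) := by
  have h1 := abs_normSq_sub_le_of_isTest hX (fun t ht => h.isTest_velF hv ha hb hX ht) ht hη
  rw [h.re_inner_velF_rhsF hv ⟨ha.trans ht.1.le, ht.2.trans_lt hb⟩] at h1
  filter_upwards [h1] with s hs
  rw [norm_velF_sq, norm_velF_sq] at hs
  convert hs using 2
  ring

theorem IsNSSolution.continuousOn_energy (h : IsNSSolution T u p) (hv : IsSlices T u v)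
    (ha : 0 ≤ a) (hb : b < T) (hX : ∀ r ∈ Set.Icc a b, ‖rhsF v r‖ ≤ C) :
    ContinuousOn (fun t => sob 0 (vel v t)) (Set.Icc a b) := by
  simp only [← norm_velF_sq]
  exact (h.continuousOn_velF hv ha hb hX).norm.pow 2

theorem IsNSSolution.energy_le (h : IsNSSolution T u p) (hv : IsSlices T u v)
    (ha : 0 ≤ a) (hab : a ≤ b) (hb : b < T) (hX : ∀ r ∈ Set.Icc a b, ‖rhsF v r‖ ≤ C) :
    sob 0 (vel v b) ≤ sob 0 (vel v a) := by
  have key := mul_le_mul_of_left_dini (f := fun t => sob 0 (vel v t)) (ψ := fun _ => 1)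
    (ψ' := fun _ => 0) (c := fun t => -(8 * Real.pi ^ 2 * sob 2 (vel v t))) hab
    (h.continuousOn_energy hv ha hb hX) (fun t _ => hasDerivAt_const _ _) (fun _ _ => one_pos)
    (fun t _ => by
      have := sob_nonneg 2 (vel v t)
      have : 0 ≤ 8 * Real.pi ^ 2 * sob 2 (vel v t) := by positivity
      linarith)
    (fun t ht η hη => by
      filter_upwards [h.energy_left_deriv hv ha hb hX ht hη] with s hs
      have := (abs_le.1 hs).2
      linarith)
  simpa using key

theorem IsNSSolution.energy_backward_le (h : IsNSSolution T u p) (hv : IsSlices T u v)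
    (ha : 0 ≤ a) (hab : a ≤ b) (hb : b < T) (hX : ∀ r ∈ Set.Icc a b, ‖rhsF v r‖ ≤ C)
    (hD : ∀ t ∈ Set.Icc a b, sob 5 (vel v t) ≤ D) :
    sob 0 (vel v a) + D ≤ (sob 0 (vel v b) + D) * Real.exp (8 * Real.pi ^ 2 * (b - a)) := by
  have hψ : ∀ t : ℝ, HasDerivAt (fun t => Real.exp (8 * Real.pi ^ 2 * t))
      (8 * Real.pi ^ 2 * Real.exp (8 * Real.pi ^ 2 * t)) t := by
    intro t
    have := ((hasDerivAt_id t).const_mul (8 * Real.pi ^ 2)).exp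
    simpa [mul_comm] using this
  have key := mul_le_mul_of_left_dini (f := fun t => -(sob 0 (vel v t) + D))
    (c := fun t => 8 * Real.pi ^ 2 * sob 2 (vel v t)) hab
    ((h.continuousOn_energy hv ha hb hX).add continuousOn_const).neg
    (fun t _ => hψ t) (fun _ _ => Real.exp_pos _)
    (fun t ht => by
      have h1 := sob_le_of_le (κ := 2) (σ := 5) (by norm_num) (by norm_num) (vel v t)
      have h2 := hD t (Set.Ioc_subset_Icc_self ht)
      have h3 : 0 ≤ 8 * Real.pi ^ 2 * Real.exp (8 * Real.pi ^ 2 * t) *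
          (sob 0 (vel v t) + D - sob 2 (vel v t)) := mul_nonneg (by positivity) (by linarith)
      linarith)
    (fun t ht η hη => by
      filter_upwards [h.energy_left_deriv hv ha hb hX ht hη] with s hs
      have := (abs_le.1 hs).1
      linarith)
  have e : Real.exp (8 * Real.pi ^ 2 * b) =
      Real.exp (8 * Real.pi ^ 2 * (b - a)) * Real.exp (8 * Real.pi ^ 2 * a) := by
    rw [← Real.exp_add]; ring_nf
  rw [e, ← mul_assoc] at key
  have := le_of_mul_le_mul_right key (Real.exp_pos _)
  linarith

theorem IsNSSolution.energy_le_of_bound_Ioc (h : IsNSSolution T u p) (hv : IsSlices T u v)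
    (ha : 0 ≤ a) (hab : a ≤ b) (hb : b < T)
    (hD : ∀ t ∈ Set.Icc a b, sob 5 (vel v t) ≤ D)
    (hloc : ∀ r ∈ Set.Ioc a b, ∃ Y, ∀ q ∈ Set.Icc r b, sob 0 (vel v q) ≤ Y) :
    sob 0 (vel v b) ≤ sob 0 (vel v a) := by
  have hD0 : 0 ≤ D := (sob_nonneg _ _).trans (hD a ⟨le_rfl, hab⟩)
  have hbd : ∀ r ∈ Set.Icc a b, sob 0 (vel v r) ≤ max (sob 0 (vel v a))
      ((sob 0 (vel v b) + D) * Real.exp (8 * Real.pi ^ 2 * (b - a))) := by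
    intro r hr
    rcases hr.1.eq_or_lt with rfl | har
    · exact le_max_left _ _
    refine le_trans ?_ (le_max_right _ _)
    obtain ⟨Y, hY⟩ := hloc r ⟨har, hr.2⟩
    have hDr : ∀ t ∈ Set.Icc r b, sob 5 (vel v t) ≤ D := fun t ht => hD t ⟨hr.1.trans ht.1, ht.2⟩
    obtain ⟨C, hC⟩ := exists_norm_rhsF_le v hDr hY
    have h1 := h.energy_backward_le hv (ha.trans hr.1) hr.2 hb hC hDr
    have h0 := sob_nonneg 0 (vel v b)
    calc sob 0 (vel v r) ≤ (sob 0 (vel v b) + D) * Real.exp (8 * Real.pi ^ 2 * (b - r)) := by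
          linarith
      _ ≤ _ := by gcongr
  obtain ⟨C, hC⟩ := exists_norm_rhsF_le v hD hbd
  exact h.energy_le hv ha hab hb hC

open scoped Topology in
theorem IsNSSolution.isClosed_energy_le (h : IsNSSolution T u p) (hv : IsSlices T u v)
    (ha : 0 ≤ a) (hb : b < T) (c : ℝ) :
    IsClosed {t | t ∈ Set.Icc a b ∧ sob 0 (vel v t) ≤ c} := by
  have hsub : Set.Icc a b ⊆ Set.Ico 0 T := fun r hr => ⟨ha.trans hr.1, hr.2.trans_lt hb⟩
  refine IsSeqClosed.isClosed fun x t hx hxt => ?_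
  have ht : t ∈ Set.Icc a b := isClosed_Icc.mem_of_tendsto hxt (Eventually.of_forall fun n => (hx n).1)
  refine ⟨ht, ?_⟩
  have hint : ∀ s l, Integrable fun x => ‖vel v s l x‖ ^ 2 :=
    fun s l => ((vel v s l).memLp 2).norm.integrable_sq
  have heq : ∀ s, ENNReal.ofReal (sob 0 (vel v s)) =
      ∫⁻ x, ENNReal.ofReal (∑ l, ‖vel v s l x‖ ^ 2) := by
    intro s
    rw [sob_zero_eq, ← integral_finsetSum _ fun l _ => hint s l]
    exact ofReal_integral_eq_lintegral_ofReal (integrable_finsetSum _ fun l _ => hint s l)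
      (Eventually.of_forall fun x => by positivity)
  have hc : 0 ≤ c := (sob_nonneg _ _).trans (hx 0).2
  have hlim : ∀ y, Tendsto (fun n => ENNReal.ofReal (∑ l, ‖vel v (x n) l y‖ ^ 2)) atTop
      (𝓝 (ENNReal.ofReal (∑ l, ‖vel v t l y‖ ^ 2))) := by
    intro y
    refine (ENNReal.continuous_ofReal.tendsto _).comp (tendsto_finsetSum _ fun l _ => ?_)
    have h1 : Tendsto (fun n => ((u (x n) y l : ℝ) : ℂ)) atTop (𝓝 ((u t y l : ℝ) : ℂ)) := by
      have hcont := (h.hasDerivWithinAt_slices hv (hsub ht) y l).continuousWithinAt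
      exact hcont.tendsto.comp (tendsto_nhdsWithin_iff.2
        ⟨hxt, Eventually.of_forall fun n => hsub (hx n).1⟩)
    have h2 := h1.norm.pow 2
    simp only [hv t (hsub ht) l y, hv _ (hsub (hx _).1) l y] at h2
    exact h2
  have hle : ENNReal.ofReal (sob 0 (vel v t)) ≤ ENNReal.ofReal c := by
    rw [heq t]
    calc ∫⁻ y, ENNReal.ofReal (∑ l, ‖vel v t l y‖ ^ 2)
        = ∫⁻ y, liminf (fun n => ENNReal.ofReal (∑ l, ‖vel v (x n) l y‖ ^ 2)) atTop := by
          congr 1; funext y; exact (hlim y).liminf_eq.symm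
      _ ≤ liminf (fun n => ∫⁻ y, ENNReal.ofReal (∑ l, ‖vel v (x n) l y‖ ^ 2)) atTop := by
          refine lintegral_liminf_le fun n => ?_
          refine ENNReal.measurable_ofReal.comp (Continuous.measurable ?_)
          exact continuous_finsetSum _ fun l _ => ((vel v (x n) l).continuous.norm.pow 2)
      _ ≤ ENNReal.ofReal c := by
          refine (liminf_le_liminf (v := fun _ => ENNReal.ofReal c)
            (Eventually.of_forall fun n => ?_)).trans (by simp)
          rw [← heq]
          exact ENNReal.ofReal_le_ofReal (hx n).2
  exact (ENNReal.ofReal_le_ofReal_iff hc).1 hle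

/-- An a priori bound in `Ḣ^{5/2}` makes the energy locally bounded. -/
theorem IsNSSolution.exists_energy_bound (h : IsNSSolution T u p) (hv : IsSlices T u v)
    (ha : 0 ≤ a) (hb : b < T) (hD : ∀ t ∈ Set.Icc a b, sob 5 (vel v t) ≤ D) :
    ∃ Y, ∀ t ∈ Set.Icc a b, sob 0 (vel v t) ≤ Y :=
  exists_bound_of_isClosed_sublevel (h.isClosed_energy_le hv ha hb)
    fun _ hs _ ht hst hloc => h.energy_le_of_bound_Ioc hv (ha.trans hs.1) hst (ht.2.trans_lt hb)
      (fun r hr => hD r ⟨hs.1.trans hr.1, hr.2.trans ht.2⟩) hloc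

end Solution

theorem norm_weightField_fourier_sq {κ : ℝ} (hκ : 0 ≤ κ) (V : Fin 3 → 𝓢(Ell 3, ℂ)) :
    ‖weightField hκ fun l => 𝓕 (V l)‖ ^ 2 = sob (4 * κ) V := by
  rw [weightField, norm_mkField_sq, sob]
  refine Finset.sum_congr rfl fun l _ => integral_congr_ae (Eventually.of_forall fun ξ => ?_)
  simp only [norm_mul, Complex.norm_real, mul_pow]
  rw [Real.norm_of_nonneg (by positivity), ← Real.rpow_natCast, ← Real.rpow_mul (norm_nonneg _)]
  congr 2
  push_cast; ring

theorem weightField_fourier_sub {κ : ℝ} (hκ : 0 ≤ κ) (V Z : Fin 3 → 𝓢(Ell 3, ℂ)) :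
    (weightField hκ fun l => 𝓕 (V l)) - (weightField hκ fun l => 𝓕 (Z l)) =
      weightField hκ fun l => 𝓕 ((V - Z) l) := by
  rw [weightField, weightField, mkField_sub, weightField]
  refine mkField_congr _ _ ?_
  funext l ξ
  have : 𝓕 ((V - Z) l) = 𝓕 (V l) - 𝓕 (Z l) := by
    exact map_sub (FourierTransform.fourierCLM ℂ 𝓢(Ell 3, ℂ)) (V l) (Z l)
  rw [this, _root_.sub_apply, Pi.sub_apply]
  ring

theorem inner_weightField_weightField {κ : ℝ} (hκ : 0 ≤ κ) (k f : Fin 3 → 𝓢(Ell 3, ℂ)) :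
    ⟪weightField hκ k, weightField hκ f⟫_ℂ =
      ⟪weightField (add_nonneg hκ hκ) k, schwartzField f⟫_ℂ := by
  rw [inner_weightField_schwartzField, weightField, weightField, inner_mkField]
  refine Finset.sum_congr rfl fun l _ => integral_congr_ae (Eventually.of_forall fun ξ => ?_)
  simp only
  rw [mul_add, Real.rpow_add_of_nonneg (norm_nonneg _) (by positivity) (by positivity)]
  simp only [map_mul, Complex.conj_ofReal, Complex.ofReal_mul]
  ring

theorem sob_sub_le {κ : ℝ} (hκ : 0 ≤ κ) (V Z : Fin 3 → 𝓢(Ell 3, ℂ)) :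
    sob κ (V - Z) ≤ 2 * (sob κ V + sob κ Z) := by
  have hκ4 : 0 ≤ κ / 4 := by positivity
  have e : 4 * (κ / 4) = κ := by ring
  have h : ∀ V, ‖weightField hκ4 fun l => 𝓕 (V l)‖ ^ 2 = sob κ V := fun V => by
    rw [norm_weightField_fourier_sq, e]
  rw [← h, ← h, ← h, ← weightField_fourier_sub]
  have h1 := norm_sub_le (weightField hκ4 fun l => 𝓕 (V l)) (weightField hκ4 fun l => 𝓕 (Z l))
  have h2 := pow_le_pow_left₀ (norm_nonneg _) h1 2
  nlinarith [sq_nonneg (‖weightField hκ4 fun l => 𝓕 (V l)‖ - ‖weightField hκ4 fun l => 𝓕 (Z l)‖)]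

theorem sob_three_le {R : ℝ} (hR : 0 < R) (V : Fin 3 → 𝓢(Ell 3, ℂ)) :
    sob 3 V ≤ R ^ 3 * sob 0 V + sob 5 V / R ^ 2 := by
  rw [sob, sob, sob, Finset.mul_sum, Finset.sum_div, ← Finset.sum_add_distrib]
  refine Finset.sum_le_sum fun l _ => ?_
  rw [← integral_const_mul, ← integral_div, ← integral_add
    ((integrable_rpow_mul_normSq le_rfl _).const_mul _)
    ((integrable_rpow_mul_normSq (by norm_num) _).div_const _)]
  refine integral_mono (integrable_rpow_mul_normSq (by norm_num) _)
    (((integrable_rpow_mul_normSq le_rfl _).const_mul _).add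
    ((integrable_rpow_mul_normSq (by norm_num) _).div_const _)) fun ξ => ?_
  have h3 : ‖ξ‖ ^ (3 : ℝ) = ‖ξ‖ ^ 3 := by exact_mod_cast Real.rpow_natCast ‖ξ‖ 3
  have h5 : ‖ξ‖ ^ (5 : ℝ) = ‖ξ‖ ^ 5 := by exact_mod_cast Real.rpow_natCast ‖ξ‖ 5
  simp only [h3, h5, Real.rpow_zero, one_mul]
  rw [mul_div_right_comm, ← add_mul]
  refine mul_le_mul_of_nonneg_right ?_ (by positivity)
  rcases le_total ‖ξ‖ R with h | h
  · have : ‖ξ‖ ^ 3 ≤ R ^ 3 := pow_le_pow_left₀ (norm_nonneg _) h 3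
    have : 0 ≤ ‖ξ‖ ^ 5 / R ^ 2 := by positivity
    linarith
  · have : ‖ξ‖ ^ 3 ≤ ‖ξ‖ ^ 5 / R ^ 2 := by
      rw [le_div_iff₀ (by positivity)]
      have h2 := pow_le_pow_left₀ hR.le h 2
      calc ‖ξ‖ ^ 3 * R ^ 2 ≤ ‖ξ‖ ^ 3 * ‖ξ‖ ^ 2 := by gcongr
        _ = ‖ξ‖ ^ 5 := by ring
    have : 0 ≤ R ^ 3 := by positivity
    linarith

section Solution

variable {T : ℝ} {u : ℝ → Ell 3 → Fin 3 → ℝ} {p : ℝ → Ell 3 → ℝ}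
  {v : ℝ → Fin 3 → 𝓢(Ell 3, ℝ)} {a b C D Y : ℝ}

/-- The field `|ξ|^{3/2} û(t)`. -/
def velW (v : ℝ → Fin 3 → 𝓢(Ell 3, ℝ)) (t : ℝ) : L2Field :=
  weightField (κ := 3 / 4) (by norm_num) fun l => 𝓕 (vel v t l)

theorem norm_velW_sq (v : ℝ → Fin 3 → 𝓢(Ell 3, ℝ)) (t : ℝ) :
    ‖velW v t‖ ^ 2 = sob 3 (vel v t) := by
  rw [velW, norm_weightField_fourier_sq]; norm_num

theorem norm_velW_sub_sq (v : ℝ → Fin 3 → 𝓢(Ell 3, ℝ)) (s t : ℝ) :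
    ‖velW v s - velW v t‖ ^ 2 = sob 3 (vel v s - vel v t) := by
  rw [velW, velW, weightField_fourier_sub _ (vel v s) (vel v t), norm_weightField_fourier_sq]
  norm_num

theorem norm_velF_sub_sq (v : ℝ → Fin 3 → 𝓢(Ell 3, ℝ)) (s t : ℝ) :
    ‖velF v s - velF v t‖ ^ 2 = sob 0 (vel v s - vel v t) := by
  have h := weightField_fourier_sub le_rfl (vel v s) (vel v t)
  rw [weightField_zero, weightField_zero] at h
  have h2 : velF v s - velF v t = weightField le_rfl fun l => 𝓕 ((vel v s - vel v t) l) := h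
  rw [h2, norm_weightField_fourier_sq, mul_zero]

theorem continuousOn_velW (hD : ∀ t ∈ Set.Icc a b, sob 5 (vel v t) ≤ D)
    (hc : ContinuousOn (velF v) (Set.Icc a b)) : ContinuousOn (velW v) (Set.Icc a b) := by
  intro t ht
  have hD0 : 0 ≤ D := (sob_nonneg _ _).trans (hD t ht)
  rw [Metric.continuousWithinAt_iff']
  intro η hη
  obtain ⟨R, hR, hRη⟩ : ∃ R : ℝ, 0 < R ∧ 4 * D / R ^ 2 < η ^ 2 / 2 := by
    refine ⟨Real.sqrt ((8 * D + 1) / η ^ 2), by positivity, ?_⟩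
    rw [Real.sq_sqrt (by positivity), div_div_eq_mul_div, div_lt_div_iff₀ (by positivity) two_pos]
    nlinarith [sq_pos_of_pos hη]
  have h1 := (Metric.continuousWithinAt_iff'.1 (hc t ht)) (Real.sqrt (η ^ 2 / 2 / R ^ 3))
    (by positivity)
  filter_upwards [h1, self_mem_nhdsWithin] with s hs hsm
  rw [dist_eq_norm] at hs ⊢
  have h2 : ‖velF v s - velF v t‖ ^ 2 < η ^ 2 / 2 / R ^ 3 := by
    rwa [← Real.lt_sqrt (norm_nonneg _)]
  rw [norm_velF_sub_sq, lt_div_iff₀ (by positivity)] at h2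
  have h3 := sob_three_le hR (vel v s - vel v t)
  have h4 : sob 5 (vel v s - vel v t) / R ^ 2 ≤ 4 * D / R ^ 2 := by
    gcongr
    have := sob_sub_le (κ := 5) (by norm_num) (vel v s) (vel v t)
    linarith [hD s hsm, hD t ht]
  have h5 : ‖velW v s - velW v t‖ ^ 2 < η ^ 2 := by
    rw [norm_velW_sub_sq]; linarith
  exact lt_of_pow_lt_pow_left₀ 2 hη.le h5

open scoped Topology in
theorem IsNSSolution.sob_three_left_dini (h : IsNSSolution T u p) (hv : IsSlices T u v)
    (ha : 0 ≤ a) (hb : b < T) (hX : ∀ r ∈ Set.Icc a b, ‖rhsF v r‖ ≤ C)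
    {t : ℝ} (ht : t ∈ Set.Ioc a b) {η : ℝ} (hη : 0 < η) :
    ∀ᶠ s in 𝓝[<] t, sob 3 (vel v t) - sob 3 (vel v s) ≤
      (2 * ‖⟪weightField (κ := 3 / 4 + 3 / 4) (by norm_num) fun l => 𝓕 (vel v t l),
        schwartzField fun l => 𝓕 (advS (vel v t) l)⟫_ℂ‖ + η) * (t - s) := by
  have hκ : (0 : ℝ) ≤ 3 / 4 := by norm_num
  have h1 := (h.isTest_weightField_vel hv ha hb hX (add_nonneg hκ hκ)
    (Set.Ioc_subset_Icc_self ht)).abs_re_inner_sub_le ht (half_pos hη)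
  have h2 := inner_weightField_rhsS (add_nonneg hκ hκ) (vel v t)
  have h2' : ⟪weightField (add_nonneg hκ hκ) fun l => 𝓕 (vel v t l), rhsF v t⟫_ℂ = _ := h2
  rw [h2'] at h1
  filter_upwards [h1, self_mem_nhdsWithin] with s hs hst
  have hst' : 0 < t - s := sub_pos.2 hst
  set w := weightField (add_nonneg hκ hκ) fun l => 𝓕 (vel v t l) with hw
  set N := schwartzField fun l => 𝓕 (advS (vel v t) l) with hN
  have h3 : ⟪w, velF v t - velF v s⟫_ℂ = ⟪velW v t, velW v t - velW v s⟫_ℂ := by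
    rw [inner_sub_right, inner_sub_right, velW, velW, inner_weightField_weightField,
      inner_weightField_weightField]
    rfl
  rw [h3, Complex.sub_re, Complex.neg_re, Complex.ofReal_re] at hs
  have h4 := Complex.abs_re_le_norm ⟪w, N⟫_ℂ
  have h5 : ‖velW v t‖ ^ 2 - ‖velW v s‖ ^ 2 ≤ 2 * (⟪velW v t, velW v t - velW v s⟫_ℂ).re := by
    have h6 : ‖velW v s‖ ^ 2 = ‖velW v t - (velW v t - velW v s)‖ ^ 2 := by
      rw [sub_sub_cancel]
    have h7 := norm_sub_sq (𝕜 := ℂ) (velW v t) (velW v t - velW v s)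
    rw [h6, h7]
    simp only [RCLike.re_to_complex]
    nlinarith [sq_nonneg ‖velW v t - velW v s‖]
  rw [norm_velW_sq, norm_velW_sq] at h5
  have h6 := (abs_le.1 hs).2
  have h7 : 0 ≤ 4 * Real.pi ^ 2 * sob (2 * (3 / 4 + 3 / 4) + 2) (vel v t) :=
    mul_nonneg (by positivity) (sob_nonneg _ _)
  have h8 := mul_nonneg h7 hst'.le
  have h9 := mul_le_mul_of_nonneg_right ((neg_le_abs _).trans h4) hst'.le
  show _ ≤ (2 * ‖⟪w, N⟫_ℂ‖ + η) * (t - s)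
  linarith

end Solution

theorem integral_smul_fourierInv {a g : Ell 3 → ℂ} (ha : Integrable a) (hg : Integrable g) :
    ∫ x, g x • 𝓕⁻ a x = ∫ x, 𝓕⁻ g x • a x := by
  have h := VectorFourier.integral_fourierIntegral_smul_eq_flip (L := -innerₗ (Ell 3))
    (μ := volume) (ν := volume)
    Real.continuous_fourierChar (by simp; fun_prop) hg ha
  have e : (-innerₗ (Ell 3)).flip = -innerₗ (Ell 3) := by
    ext x y
    simp [real_inner_comm]
  rw [e] at h
  exact h.symm

theorem continuous_fourierInv {a : Ell 3 → ℂ} (ha : Integrable a) : Continuous (𝓕⁻ a) :=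
  VectorFourier.fourierIntegral_continuous Real.continuous_fourierChar
    (by simp; fun_prop) ha

/-- The `L²` inverse Fourier transform is given by the inverse Fourier integral on `L¹ ∩ L²`. -/
theorem coeFn_fourierInv_toLp {a : Ell 3 → ℂ} (h1 : Integrable a) (h2 : MemLp a 2 volume) :
    (𝓕⁻ a : Ell 3 → ℂ) =ᵐ[volume] (𝓕⁻ (h2.toLp a) : Lp ℂ 2 (volume : Measure (Ell 3))) := by
  refine ae_eq_of_integral_contDiff_smul_eq (continuous_fourierInv h1).locallyIntegrable
    ((Lp.memLp _).locallyIntegrable (by norm_num)) fun g hg hgc => ?_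
  have hgc' : HasCompactSupport fun x => (g x : ℂ) :=
    hgc.comp_left (g := fun r : ℝ => (r : ℂ)) (by simp)
  let G : 𝓢(Ell 3, ℂ) := hgc'.toSchwartzMap (Complex.ofRealCLM.contDiff.comp hg)
  have hG : ∀ x, G x = (g x : ℂ) := fun x => rfl
  have e : ∀ (F : Ell 3 → ℂ), ∫ x, g x • F x = ∫ x, G x • F x := fun F => by
    simp [hG]
  rw [e, e, integral_smul_fourierInv h1 G.integrable, ← Lp.toTemperedDistribution_apply,
    ← Lp.fourierInv_toTemperedDistribution_eq, TemperedDistribution.fourierInv_apply,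
    Lp.toTemperedDistribution_apply]
  refine integral_congr_ae ?_
  filter_upwards [h2.coeFn_toLp] with x hx
  rw [hx, SchwartzMap.fourierInv_coe]

theorem integral_conj_fourierInv_mul {a b : Ell 3 → ℂ} (ha : Integrable a)
    (ha2 : MemLp a 2 volume) (hb : Integrable b) (hb2 : MemLp b 2 volume) :
    ∫ x, conj (𝓕⁻ a x) * 𝓕⁻ b x = ∫ ξ, conj (a ξ) * b ξ := by
  have h := Lp.inner_fourier_eq (𝓕⁻ (ha2.toLp a) : Lp ℂ 2 (volume : Measure (Ell 3)))
    (𝓕⁻ (hb2.toLp b))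
  rw [FourierTransform.fourier_fourierInv_eq, FourierTransform.fourier_fourierInv_eq,
    L2.inner_def, L2.inner_def] at h
  have e1 : ∫ ξ, ⟪ha2.toLp a ξ, hb2.toLp b ξ⟫_ℂ = ∫ ξ, conj (a ξ) * b ξ := by
    refine integral_congr_ae ?_
    filter_upwards [ha2.coeFn_toLp, hb2.coeFn_toLp] with x hx hy
    rw [hx, hy, RCLike.inner_apply, mul_comm]
  rw [← e1, h]
  refine integral_congr_ae ?_
  filter_upwards [coeFn_fourierInv_toLp ha ha2, coeFn_fourierInv_toLp hb hb2] with x hx hy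
  rw [← hx, ← hy, RCLike.inner_apply, mul_comm]

theorem conj_fourierInv (a : Ell 3 → ℂ) (x : Ell 3) :
    conj (𝓕⁻ a x) = 𝓕⁻ (fun ξ => conj (a (-ξ))) x := by
  rw [Real.fourierInv_eq, Real.fourierInv_eq, ← integral_conj, ← integral_neg_eq_self]
  refine integral_congr_ae (Eventually.of_forall fun ξ => ?_)
  simp [Circle.smul_def, ← Circle.coe_inv_eq_conj, AddChar.map_neg_eq_inv]

theorem conj_fourier (f : Ell 3 → ℂ) (ξ : Ell 3) :
    conj (𝓕 f (-ξ)) = 𝓕 (fun x => conj (f x)) ξ := by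
  rw [Real.fourier_eq, Real.fourier_eq, ← integral_conj]
  refine integral_congr_ae (Eventually.of_forall fun x => ?_)
  simp [Circle.smul_def, ← Circle.coe_inv_eq_conj, AddChar.map_neg_eq_inv]

/-- `Λ^s` preserves real-valuedness. -/
theorem conj_Lam_cf (s : ℝ) (f : Ell 3 → ℝ) (x : Ell 3) : conj (Lam s (cf f) x) = Lam s (cf f) x := by
  rw [Lam, conj_fourierInv]
  refine congrArg (fun F : Ell 3 → ℂ => 𝓕⁻ F x) ?_
  funext ξ
  rw [map_mul, conj_fourier, norm_neg, Complex.conj_ofReal]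
  have : (fun x => conj (cf f x)) = cf f := funext fun x => Complex.conj_ofReal (f x)
  rw [this]

theorem integrable_weight {κ : ℝ} (hκ : 0 ≤ κ) (f : 𝓢(Ell 3, ℂ)) :
    Integrable fun ξ => ((‖ξ‖ ^ (2 * κ) : ℝ) : ℂ) * f ξ := by
  have hg : (fun ξ : Ell 3 => (1 + ‖ξ‖ ^ 2) ^ κ).HasTemperateGrowth :=
    Function.hasTemperateGrowth_one_add_norm_sq_rpow (Ell 3) _
  have hm : Integrable (rmulS (fun ξ : Ell 3 => (1 + ‖ξ‖ ^ 2) ^ κ) f) := (rmulS _ f).integrable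
  refine hm.mono (memLp_weight hκ f).1 (Eventually.of_forall fun ξ => ?_)
  rw [rmulS_apply hg, norm_mul, norm_mul, Complex.norm_real, Complex.norm_real,
    Real.norm_of_nonneg (by positivity), Real.norm_of_nonneg (by positivity)]
  gcongr
  exact rpow_le_one_add_sq hκ ξ

theorem adv_cf (v : Fin 3 → 𝓢(Ell 3, ℝ)) (l : Fin 3) :
    adv (fun i => cf (v i)) (fun l' => cf (v l')) l = advS (fun i => cxS (v i)) l := by
  funext x
  rw [advS_apply]
  refine Finset.sum_congr rfl fun i _ => ?_
  rw [sd_apply]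
  rfl

theorem Cinner_Lam_adv (v : Fin 3 → 𝓢(Ell 3, ℝ)) :
    Cinner (fun l => Lam (3 / 2) (adv (fun i => cf (v i)) (fun l' => cf (v l')) l))
        (fun l => Lam (3 / 2) (cf (v l))) =
      ⟪weightField (κ := 3 / 4 + 3 / 4) (by norm_num) fun l => 𝓕 (cxS (v l)),
        schwartzField fun l => 𝓕 (advS (fun i => cxS (v i)) l)⟫_ℂ := by
  have hκ : (0 : ℝ) ≤ 3 / 4 := by norm_num
  have hLam : ∀ f : 𝓢(Ell 3, ℂ),
      Lam (3 / 2) f = 𝓕⁻ fun ξ => ((‖ξ‖ ^ (2 * (3 / 4) : ℝ) : ℝ) : ℂ) * 𝓕 f ξ := fun f => by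
    rw [Lam]; norm_num; rfl
  rw [← inner_weightField_weightField hκ, weightField, weightField, inner_mkField, Cinner]
  refine Finset.sum_congr rfl fun l _ => ?_
  rw [← integral_conj_fourierInv_mul (integrable_weight hκ _) (memLp_weight hκ _)
    (integrable_weight hκ _) (memLp_weight hκ _), ← hLam, ← hLam, ← adv_cf]
  refine integral_congr_ae (Eventually.of_forall fun x => ?_)
  have h := conj_Lam_cf (3 / 2) (v l) x
  have h' : conj (Lam (3 / 2) (cxS (v l)) x) = Lam (3 / 2) (cf (v l)) x := h
  simp only
  rw [h', mul_comm]

end Prelude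

/-- **Contradiction step for the weak Ḣ^{5/2} bound.** Let `(u,p)` be a smooth
(Schwartz-in-space) solution of the 3D Navier–Stokes equations on `[0,T)`, let
`c₀ > 0` satisfy `|⟨Λ^{3/2}[(v·∇)v], Λ^{3/2}v⟩| ≤ c₀‖v‖²_{Ḣ^{3/2}}‖v‖_{Ḣ^{5/2}}`
for all divergence-free Schwartz fields `v`, let `ε > 0` with `2c₀ε < 1`, and
suppose `‖u(t)‖_{Ḣ^{5/2}} ≤ ε(T−t)^{−1}` on `[τ,T)`. Then
`‖u(t)‖²_{Ḣ^{3/2}} ≤ ‖u(τ)‖²_{Ḣ^{3/2}}(T−τ)^{2c₀ε}(T−t)^{−2c₀ε}` on `[τ,T)`;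
in particular `(T−t)^{2c₀ε}‖u(t)‖²_{Ḣ^{3/2}}` is bounded on `[τ,T)`. -/
theorem H32_bound_under_H52_control (T : ℝ) (hT : 0 < T)
    (u : ℝ → Ell 3 → Fin 3 → ℝ) (p : ℝ → Ell 3 → ℝ) (hsol : IsNSSolution T u p)
    (c₀ : ℝ) (hc₀ : 0 < c₀)
    (hc₀ineq : ∀ v : Fin 3 → 𝓢(Ell 3, ℝ),
      (∀ x, ∑ i, fderiv ℝ (fun y => v i y) x (eVec 3 i) = 0) →
      ‖Cinner (fun l => Lam (3 / 2) (adv (fun i => cf (v i)) (fun l' => cf (v l')) l))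
          (fun l => Lam (3 / 2) (cf (v l)))‖
        ≤ c₀ * Hnorm (3 / 2) (fun l x => v l x) ^ 2 * Hnorm (5 / 2) (fun l x => v l x))
    (ε : ℝ) (hε : 0 < ε) (hεsmall : 2 * c₀ * ε < 1)
    (τ : ℝ) (hτ : τ ∈ Set.Ico (0 : ℝ) T)
    (hctrl : ∀ t ∈ Set.Ico τ T,
      Hnorm (5 / 2) (fun l x => u t x l) ≤ ε * (T - t)⁻¹) :
    (∀ t ∈ Set.Ico τ T,
      Hnorm (3 / 2) (fun l x => u t x l) ^ 2
        ≤ Hnorm (3 / 2) (fun l x => u τ x l) ^ 2 * (T - τ) ^ (2 * c₀ * ε)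
            * (T - t) ^ (-(2 * c₀ * ε))) ∧
    ∃ M : ℝ, ∀ t ∈ Set.Ico τ T,
      (T - t) ^ (2 * c₀ * ε) * Hnorm (3 / 2) (fun l x => u t x l) ^ 2 ≤ M := by
  obtain ⟨v, hv⟩ := hsol.exists_slices
  have hH : ∀ s t : ℝ, t ∈ Set.Ico 0 T →
      Hnorm s (fun l x => u t x l) = Hnorm s (fun l x => v t l x) := fun s t ht => by
    congr 1
    funext l x
    exact hv t ht l x
  have hsub : ∀ {t}, t ∈ Set.Ico τ T → t ∈ Set.Ico 0 T := fun ht => ⟨hτ.1.trans ht.1, ht.2⟩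
  have h32 : ∀ t, Hnorm (3 / 2) (fun l x => v t l x) ^ 2 = sob 3 (vel v t) := fun t => by
    rw [Hnorm_sq]; norm_num; rfl
  have h52 : ∀ t, Hnorm (5 / 2) (fun l x => v t l x) ^ 2 = sob 5 (vel v t) := fun t => by
    rw [Hnorm_sq]; norm_num; rfl
  have hH0 : ∀ t, 0 ≤ Hnorm (5 / 2) (fun l x => v t l x) := fun t => Real.sqrt_nonneg _
  have hctrl' : ∀ t ∈ Set.Ico τ T, Hnorm (5 / 2) (fun l x => v t l x) ≤ ε * (T - t)⁻¹ :=
    fun t ht => hH _ t (hsub ht) ▸ hctrl t ht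
  have key : ∀ b ∈ Set.Ico τ T, sob 3 (vel v b) * (T - b) ^ (2 * c₀ * ε) ≤
      sob 3 (vel v τ) * (T - τ) ^ (2 * c₀ * ε) := by
    intro b hb
    have hmem : ∀ {t}, t ∈ Set.Icc τ b → t ∈ Set.Ico τ T := fun ht => ⟨ht.1, ht.2.trans_lt hb.2⟩
    have hD : ∀ t ∈ Set.Icc τ b, sob 5 (vel v t) ≤ (ε * (T - b)⁻¹) ^ 2 := by
      intro t ht
      rw [← h52]
      refine pow_le_pow_left₀ (hH0 t) ((hctrl' t (hmem ht)).trans ?_) 2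
      have := hb.2
      have := ht.2
      gcongr
    obtain ⟨Y, hY⟩ := hsol.exists_energy_bound hv hτ.1 hb.2 hD
    obtain ⟨C, hC⟩ := exists_norm_rhsF_le v hD hY
    have hcont : ContinuousOn (fun t => sob 3 (vel v t)) (Set.Icc τ b) := by
      simp only [← norm_velW_sq]
      exact (continuousOn_velW hD (hsol.continuousOn_velF hv hτ.1 hb.2 hC)).norm.pow 2
    have hψ : ∀ t ∈ Set.Icc τ b, HasDerivAt (fun t => (T - t) ^ (2 * c₀ * ε))
        (-1 * (2 * c₀ * ε) * (T - t) ^ (2 * c₀ * ε - 1)) t := fun t ht =>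
      ((hasDerivAt_id t).const_sub T).rpow_const (Or.inl (sub_pos.2 (hmem ht).2).ne')
    refine mul_le_mul_of_left_dini (c := fun t => 2 * (c₀ * sob 3 (vel v t) * (ε * (T - t)⁻¹)))
      hb.1 hcont hψ (fun t ht => Real.rpow_pos_of_pos (sub_pos.2 (hmem ht).2) _)
      (fun t ht => le_of_eq ?_) fun t ht η hη => ?_
    · have hpos : 0 < T - t := sub_pos.2 (hmem (Set.Ioc_subset_Icc_self ht)).2
      rw [Real.rpow_sub_one hpos.ne']
      field_simp
      ring
    · have ht' := hmem (Set.Ioc_subset_Icc_self ht)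
      filter_upwards [hsol.sob_three_left_dini hv hτ.1 hb.2 hC ht hη, self_mem_nhdsWithin]
        with s hs hst
      refine hs.trans (mul_le_mul_of_nonneg_right ?_ (sub_nonneg.2 (le_of_lt hst)))
      have h1 := hc₀ineq (v t) (hsol.div_slices hv (hsub ht'))
      rw [Cinner_Lam_adv, h32] at h1
      have h2 := h1.trans (mul_le_mul_of_nonneg_left (hctrl' t ht')
        (mul_nonneg hc₀.le (sob_nonneg 3 (vel v t))))
      gcongr
      exact h2
  refine ⟨fun t ht => ?_, sob 3 (vel v τ) * (T - τ) ^ (2 * c₀ * ε), fun t ht => ?_⟩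
  · have hpos : 0 < T - t := sub_pos.2 ht.2
    rw [hH _ t (hsub ht), hH _ τ hτ, h32, h32, Real.rpow_neg hpos.le, ← div_eq_mul_inv,
      le_div_iff₀ (Real.rpow_pos_of_pos hpos _)]
    exact key t ht
  · rw [hH _ t (hsub ht), h32, mul_comm]
    exact key t ht

end
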